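/- arXiv:0806.4009 — 2 statements merged into one kernel-verified Lean document; each statement's English description precedes it below -/
import Mathlib

section
/- Burgess's Theorem for Surfaces: Let S be a closed surface and X ⊆ S a continuum. If there exists a sequence (Uₙ) of pairwise distinct complementary domains of X such that the frontiers ∂Uₙ converge to X in the Hausdorff metric, then X is either indecomposable or 2-indecomposable. -/
open Set Metric Filter Topology

/-- A space is locally homeomorphic to ℝ²: every point has an open
neighborhood homeomorphic to the Euclidean plane. -/
def LocallyEuclidean2 (S : Type*) [TopologicalSpace S] : Prop :=
  ∀ x : S, ∃ U : Set S, IsOpen U ∧ x ∈ U ∧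
    Nonempty (U ≃ₜ EuclideanSpace ℝ (Fin 2))

section Defs

variable {S : Type*} [TopologicalSpace S]

/-- A continuum: a nonempty compact connected subset. -/
def IsContinuum (X : Set S) : Prop := IsCompact X ∧ IsConnected X

/-- A complementary domain of `X`: a connected component of the complement of `X`. -/
def IsComplementaryDomain (X U : Set S) : Prop :=
  ∃ x, x ∉ X ∧ U = connectedComponentIn Xᶜ x

/-- A proper subcontinuum of `X`. -/
def IsProperSubcontinuum (X A : Set S) : Prop :=
  A.Nonempty ∧ IsClosed A ∧ IsConnected A ∧ A ⊆ X ∧ A ≠ X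

/-- `X` is decomposable: the union of two proper subcontinua. -/
def IsDecomposable (X : Set S) : Prop :=
  ∃ A B, IsProperSubcontinuum X A ∧ IsProperSubcontinuum X B ∧ A ∪ B = X

/-- `X` is the essential union of three proper subcontinua. -/
def IsEssentialUnionOfThree (X : Set S) : Prop :=
  ∃ X₁ X₂ X₃, IsProperSubcontinuum X X₁ ∧ IsProperSubcontinuum X X₂ ∧
    IsProperSubcontinuum X X₃ ∧ X₁ ∪ X₂ ∪ X₃ = X ∧
    ¬ X₁ ⊆ X₂ ∪ X₃ ∧ ¬ X₂ ⊆ X₁ ∪ X₃ ∧ ¬ X₃ ⊆ X₁ ∪ X₂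

/-- `X` is 2-indecomposable: decomposable but not the essential union of
three proper subcontinua. -/
def Is2Indecomposable (X : Set S) : Prop :=
  IsDecomposable X ∧ ¬ IsEssentialUnionOfThree X

/-- `X` is shielded: no complementary domain has frontier equal to `X`. -/
def IsShielded (X : Set S) : Prop :=
  ∀ U, IsComplementaryDomain X U → frontier U ≠ X

/-- A generalized crosscut of `U`. -/
def IsGenCrosscut (U A : Set S) : Prop :=
  A ⊆ U ∧ Nonempty (A ≃ₜ Set.Ioo (0:ℝ) 1) ∧ closure A \ A ⊆ frontier U

/-- `T` is a shadow of the (generalized) crosscut `A` of `U`. -/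
def IsShadowOf (U A T : Set S) : Prop :=
  ∃ x ∈ U \ A, T = closure (connectedComponentIn (U \ A) x) ∩ frontier U

/-- An arc with endpoints `a` and `b`. -/
def IsArcFrom (A : Set S) (a b : S) : Prop :=
  ∃ f : Set.Icc (0:ℝ) 1 → S, Continuous f ∧ Function.Injective f ∧
    Set.range f = A ∧ f ⟨0, by norm_num⟩ = a ∧ f ⟨1, by norm_num⟩ = b

/-- A crosscut of `U`: a copy of `(0,1)` in `U` whose closure is an arc
meeting the frontier of `U` exactly at the endpoints of the arc. -/
def IsCrosscut (U K : Set S) : Prop :=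
  K ⊆ U ∧ Nonempty (K ≃ₜ Set.Ioo (0:ℝ) 1) ∧
    ∃ a b, IsArcFrom (closure K) a b ∧ closure K ∩ frontier U = {a, b}

/-- A closed disk: a set homeomorphic to the closed unit disk in ℝ². -/
def IsClosedDisk (D : Set S) : Prop :=
  Nonempty (D ≃ₜ Metric.closedBall (0 : EuclideanSpace ℝ (Fin 2)) 1)

/-- A cat's cradle between `d₁` and `d₃`: a family of arcs from `d₁` to `d₃`
whose interiors are pairwise disjoint. -/
def IsCatsCradle {ι : Type*} (d₁ d₃ : S) (A : ι → Set S) : Prop :=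
  (∀ i, IsArcFrom (A i) d₁ d₃) ∧
    Pairwise fun i j => (A i \ {d₁, d₃}) ∩ (A j \ {d₁, d₃}) = ∅

/-- A cat's cradle between `d₁` and `d₃` through `D₂`. -/
def IsCatsCradleThrough {ι : Type*} (d₁ d₃ : S) (D₂ : Set S) (A : ι → Set S) : Prop :=
  IsCatsCradle d₁ d₃ A ∧ D₂ ∩ {d₁, d₃} = ∅ ∧ ∀ i, (A i ∩ D₂).Nonempty

/-- A chord of the closed disk `D`: an arc in `D` meeting the frontier of `D`
exactly at its two endpoints. -/
def IsChord (D A : Set S) : Prop :=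
  ∃ a b, IsArcFrom A a b ∧ A ⊆ D ∧ A ∩ frontier D = {a, b}

/-- A sequence of pairwise disjoint chords of `D` is linearly ordered if each
middle chord separates the earlier ones from the later ones in `D`. -/
def LinearlyOrderedChords (D : Set S) (A : ℕ → Set S) : Prop :=
  (Pairwise fun i j => Disjoint (A i) (A j)) ∧
    ∀ i j k, i < j → j < k → ∀ x ∈ A i, ∀ y ∈ A k,
      connectedComponentIn (D \ A j) x ≠ connectedComponentIn (D \ A j) y

end Defs

section MetricDefs

variable {S : Type*} [MetricSpace S]

/-- Convergence of a sequence of sets to `X` in the Hausdorff metric. -/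
def HausdorffConvergesTo (A : ℕ → Set S) (X : Set S) : Prop :=
  Tendsto (fun n => hausdorffDist (A n) X) atTop (𝓝 0)

/-- The double-pass condition for a sequence of domains. -/
def DoublePassCondition (X : Set S) (U : ℕ → Set S) : Prop :=
  ∀ K : ℕ → Set S, (∀ n, IsGenCrosscut (U n) (K n)) →
    ∃ Sh : ℕ → Set S, (∀ n, IsShadowOf (U n) (K n) (Sh n)) ∧ HausdorffConvergesTo Sh X

/-- The double-pass condition with (genuine) crosscuts. -/
def DoublePassConditionCrosscuts (X : Set S) (U : ℕ → Set S) : Prop :=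
  ∀ K : ℕ → Set S, (∀ n, IsCrosscut (U n) (K n)) →
    ∃ Sh : ℕ → Set S, (∀ n, IsShadowOf (U n) (K n) (Sh n)) ∧ HausdorffConvergesTo Sh X

end MetricDefs

/-! ## Square roots of nonvanishing functions -/

lemma exists_sqrt_plane (f : ℂ → ℂ) (hf : Continuous f) (h0 : ∀ z, f z ≠ 0) :
    ∃ k : ℂ → ℂ, Continuous k ∧ ∀ z, k z ^ 2 = f z := by
  obtain ⟨F, ⟨-, hF⟩, -⟩ := Complex.isCoveringMapOn_exp.existsUnique_continuousMap_lifts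
    (⟨f, hf⟩ : C(ℂ, ℂ)) (a₀ := 0) (e₀ := Complex.log (f 0))
    (by simpa using Complex.exp_log (h0 0)) (by simpa using h0)
  refine ⟨fun z => Complex.exp (F z / 2), by fun_prop, fun z => ?_⟩
  have := congrFun hF z
  simp only [Function.comp_apply, ContinuousMap.coe_mk] at this
  rw [← Complex.exp_nat_mul, ← this]
  congr 1
  push_cast
  ring

/-- The unnormalised model function. -/
noncomputable def modelF (z : ℂ) : ℂ :=
  ((‖z‖ ^ 2 - z.re : ℝ) : ℂ) + ((z.im * max 0 (2 - ‖z‖) : ℝ) : ℂ) * Complex.I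

/-- The model function, of norm one away from `0` and `1`, and equal to one outside a ball. -/
noncomputable def model (z : ℂ) : ℂ := modelF z / (‖modelF z‖ : ℂ)

lemma modelF_continuous : Continuous modelF := by
  unfold modelF; fun_prop

lemma modelF_re (z : ℂ) : (modelF z).re = ‖z‖ ^ 2 - z.re := by
  rw [modelF, Complex.add_re, Complex.re_ofReal_mul, Complex.ofReal_re]; simp

lemma modelF_im (z : ℂ) : (modelF z).im = z.im * max 0 (2 - ‖z‖) := by
  rw [modelF, Complex.add_im, Complex.im_ofReal_mul, Complex.ofReal_im]; simp

lemma modelF_ne_zero {z : ℂ} (h0 : z ≠ 0) (h1 : z ≠ 1) : modelF z ≠ 0 := by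
  intro h
  have hr := modelF_re z
  have hi := modelF_im z
  rw [h] at hr hi
  simp only [Complex.zero_re, Complex.zero_im] at hr hi
  have hre := Complex.re_le_norm z
  have hn : 0 < ‖z‖ := norm_pos_iff.2 h0
  have hz : ‖z‖ ≤ 1 := by nlinarith
  rw [max_eq_right (by linarith)] at hi
  have hy : z.im = 0 := by
    rcases mul_eq_zero.1 hi.symm with h | h
    · exact h
    · linarith
  have hsq : ‖z‖ ^ 2 = z.re ^ 2 := by
    rw [Complex.sq_norm, Complex.normSq_apply, hy]; ring
  rw [hsq] at hr
  have : z.re * (z.re - 1) = 0 := by linarith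
  rcases mul_eq_zero.1 this with h | h
  · exact h0 (Complex.ext h hy)
  · exact h1 (Complex.ext (by simpa using by linarith) (by simpa using hy))

lemma model_eq_one {z : ℂ} (h : 2 ≤ ‖z‖) : model z = 1 := by
  have him : (modelF z).im = 0 := by
    rw [modelF_im, max_eq_left (by linarith)]; ring
  have hre : 0 < (modelF z).re := by
    rw [modelF_re]
    have := Complex.re_le_norm z
    nlinarith
  have hF : modelF z = ((modelF z).re : ℂ) := Complex.ext (by simp) (by simp [him])
  rw [model, hF, Complex.norm_real, Real.norm_of_nonneg hre.le]
  exact div_self (by exact_mod_cast hre.ne')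

lemma model_ne_zero {z : ℂ} (h0 : z ≠ 0) (h1 : z ≠ 1) : model z ≠ 0 := by
  have := modelF_ne_zero h0 h1
  exact div_ne_zero this (by simpa using this)

lemma model_continuousAt {z : ℂ} (h0 : z ≠ 0) (h1 : z ≠ 1) : ContinuousAt model z := by
  have := modelF_ne_zero h0 h1
  unfold model
  have hc := modelF_continuous.continuousAt (x := z)
  exact hc.div (Complex.continuous_ofReal.continuousAt.comp hc.norm) (by simpa using this)

lemma modelF_mul_re {z : ℂ} (h0 : z ≠ 0) (h1 : ‖z‖ < 1) : 0 < (-(modelF z * z)).re := by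
  rw [Complex.neg_re, Complex.mul_re, modelF_re, modelF_im, max_eq_right (by linarith)]
  have hn : 0 < ‖z‖ := norm_pos_iff.2 h0
  have hre := Complex.re_le_norm z
  have hsq : ‖z‖ ^ 2 = z.re ^ 2 + z.im ^ 2 := by
    rw [Complex.sq_norm, Complex.normSq_apply]; ring
  have h2 : 0 ≤ z.im ^ 2 * (1 - ‖z‖) := mul_nonneg (sq_nonneg _) (by linarith)
  have h3 : ‖z‖ ^ 2 * z.re < ‖z‖ ^ 2 := by
    have : 0 < ‖z‖ ^ 2 := by positivity
    nlinarith
  nlinarith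

/-- The model function has odd winding number around zero. -/
lemma model_local_sqrt : ∃ m : ℂ → ℂ, ContinuousOn m {w | w.re < 0} ∧
    (∀ w, w.re < 0 → m w ^ 2 = model (Complex.exp w)) ∧
    (∀ w, w.re < 0 → m (w + 2 * Real.pi * Complex.I) = - m w) := by
  have hper : ∀ w, Complex.exp (w + 2 * Real.pi * Complex.I) = Complex.exp w :=
    fun w => Complex.exp_periodic w
  set c : ℂ → ℂ := fun w => -(modelF (Complex.exp w) * Complex.exp w) /
    (‖modelF (Complex.exp w)‖ : ℂ) with hc
  have hlt : ∀ w : ℂ, w.re < 0 → ‖Complex.exp w‖ < 1 := fun w hw => by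
    rw [Complex.norm_exp]; simpa using hw
  have hne : ∀ w : ℂ, w.re < 0 → modelF (Complex.exp w) ≠ 0 := fun w hw => by
    refine modelF_ne_zero (Complex.exp_ne_zero _) (fun h => ?_)
    have := hlt w hw
    rw [h] at this; simp at this
  have hcs : ∀ w : ℂ, w.re < 0 → c w ∈ Complex.slitPlane := fun w hw => by
    left
    rw [hc]
    simp only
    rw [Complex.div_ofReal_re]
    exact div_pos (modelF_mul_re (Complex.exp_ne_zero _) (hlt w hw)) (norm_pos_iff.2 (hne w hw))
  have hcc : ContinuousOn c {w | w.re < 0} := by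
    have h1 : Continuous fun w => modelF (Complex.exp w) :=
      modelF_continuous.comp Complex.continuous_exp
    refine ContinuousOn.div ?_ ?_ ?_
    · exact (h1.mul Complex.continuous_exp).neg.continuousOn
    · exact (Complex.continuous_ofReal.comp h1.norm).continuousOn
    · intro w hw; simpa using hne w hw
  refine ⟨fun w => Complex.exp (Complex.log (c w) / 2) * (Complex.I * Complex.exp (-w / 2)),
    ?_, ?_, ?_⟩
  · refine ContinuousOn.mul ?_ (by fun_prop)
    exact Complex.continuous_exp.comp_continuousOn ((hcc.clog hcs).div_const 2)
  · intro w hw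
    have e1 : Complex.exp (Complex.log (c w) / 2) ^ 2 = c w := by
      rw [← Complex.exp_nat_mul]
      rw [show ((2 : ℕ) : ℂ) * (Complex.log (c w) / 2) = Complex.log (c w) by push_cast; ring]
      exact Complex.exp_log (Complex.slitPlane_ne_zero (hcs w hw))
    have e2 : Complex.exp (-w / 2) ^ 2 = (Complex.exp w)⁻¹ := by
      rw [← Complex.exp_nat_mul, ← Complex.exp_neg]
      congr 1; push_cast; ring
    rw [mul_pow, mul_pow, e1, e2, Complex.I_sq, hc, model]
    have := Complex.exp_ne_zero w
    field_simp
  · intro w hw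
    have e1 : c (w + 2 * Real.pi * Complex.I) = c w := by
      rw [hc]; simp only [hper]
    have e2 : Complex.exp (-(w + 2 * Real.pi * Complex.I) / 2) = - Complex.exp (-w / 2) := by
      rw [show -(w + 2 * Real.pi * Complex.I) / 2 = -w / 2 - Real.pi * Complex.I by ring,
        Complex.exp_sub, Complex.exp_pi_mul_I]
      ring
    simp only [e1, e2]; ring

lemma no_sqrt (G : ℂ → ℂ) (hG : ContinuousOn G {0}ᶜ) (hG0 : ∀ z, z ≠ 0 → G z ≠ 0)
    (p : ℂ) (hp : p ≠ 0) (hgerm : ∀ᶠ z in 𝓝[≠] (0 : ℂ), G z = model (z / p))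
    (h : ℂ → ℂ) (hh : ContinuousOn h (closedBall 0 1)ᶜ)
    (hsq : ∀ z ∈ (closedBall (0 : ℂ) 1)ᶜ, h z ^ 2 = G z) : False := by
  have hper : ∀ w, Complex.exp (w + 2 * Real.pi * Complex.I) = Complex.exp w :=
    fun w => Complex.exp_periodic w
  obtain ⟨k, hk, hk2⟩ := exists_sqrt_plane (fun w => G (Complex.exp w))
    (hG.comp_continuous Complex.continuous_exp fun w => Complex.exp_ne_zero w)
    (fun w => hG0 _ (Complex.exp_ne_zero w))
  have hk0 : ∀ w, k w ≠ 0 := fun w h0 => by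
    have := hk2 w
    rw [h0] at this
    exact hG0 _ (Complex.exp_ne_zero w) (by simpa using this.symm)
  obtain ⟨m, hm, hm2, hmT⟩ := model_local_sqrt
  -- deck transformation sign
  have hT := isPreconnected_univ.eq_or_eq_neg_of_sq_eq
    (f := fun w => k (w + 2 * Real.pi * Complex.I)) (g := k)
    (by fun_prop) hk.continuousOn
    (fun w _ => by simp only [Pi.pow_apply, hk2, hper]) (fun {w} _ => hk0 w)
  -- outside the unit ball
  have hconv1 : IsPreconnected {w : ℂ | 0 < w.re} := (convex_halfSpace_re_gt 0).isPreconnected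
  have hout : ∀ w : ℂ, 0 < w.re → Complex.exp w ∈ (closedBall (0 : ℂ) 1)ᶜ := fun w hw => by
    simp [Complex.norm_exp, hw]
  have h1 := hconv1.eq_or_eq_neg_of_sq_eq (f := fun w => h (Complex.exp w)) (g := k)
    (hh.comp Complex.continuous_exp.continuousOn hout) hk.continuousOn
    (fun w hw => by simp only [Pi.pow_apply, hk2]; exact hsq _ (hout w hw)) (fun {w} _ => hk0 w)
  have hre1 : ∀ w : ℂ, (w + 2 * Real.pi * Complex.I).re = w.re := fun w => by simp
  have hpos : k ((1 : ℂ) + 2 * Real.pi * Complex.I) = k 1 := by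
    have a1 : (1 : ℂ) ∈ {w : ℂ | 0 < w.re} := by simp
    have a2 : (1 : ℂ) + 2 * Real.pi * Complex.I ∈ {w : ℂ | 0 < w.re} := by
      simp only [mem_ofPred_eq, hre1]; simp
    rcases h1 with h1 | h1
    · have b1 := h1 a1
      have b2 := h1 a2
      simp only [hper] at b1 b2
      rw [← b1, ← b2]
    · have b1 := h1 a1
      have b2 := h1 a2
      simp only [hper, Pi.neg_apply] at b1 b2
      rw [b1] at b2
      exact (neg_injective b2).symm
  have hT' : ∀ w, k (w + 2 * Real.pi * Complex.I) = k w := by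
    rcases hT with hT | hT
    · exact fun w => hT (mem_univ w)
    · exfalso
      have := hT (mem_univ 1)
      simp only [Pi.neg_apply] at this
      rw [hpos] at this
      exact hk0 1 (self_eq_neg.1 this)
  -- near zero
  rw [eventually_nhdsWithin_iff, Metric.eventually_nhds_iff] at hgerm
  obtain ⟨ε, hε, hgerm⟩ := hgerm
  set a := Complex.log p
  set A := min (Real.log ε) a.re
  have hconv2 : IsPreconnected {w : ℂ | w.re < A} := (convex_halfSpace_re_lt A).isPreconnected
  have hmap : ∀ w : ℂ, w.re < A → (w - a).re < 0 := fun w hw => by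
    have := min_le_right (Real.log ε) a.re
    rw [Complex.sub_re]; linarith
  have hsm : ∀ w : ℂ, w.re < A → m (w - a) ^ 2 = k w ^ 2 := fun w hw => by
    rw [hm2 _ (hmap w hw), hk2, hgerm _ (Complex.exp_ne_zero w), Complex.exp_sub,
      Complex.exp_log hp]
    rw [dist_zero_right, Complex.norm_exp]
    have := min_le_left (Real.log ε) a.re
    rw [← Real.lt_log_iff_exp_lt hε]; linarith
  have h2 := hconv2.eq_or_eq_neg_of_sq_eq (f := fun w => m (w - a)) (g := k)
    (hm.comp (by fun_prop) hmap) hk.continuousOn (fun w hw => hsm w hw) (fun {w} _ => hk0 w)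
  set w₀ : ℂ := ((A - 1 : ℝ) : ℂ)
  have c1 : w₀ ∈ {w : ℂ | w.re < A} := by simp [w₀]
  have c2 : w₀ + 2 * Real.pi * Complex.I ∈ {w : ℂ | w.re < A} := by
    simp only [mem_ofPred_eq, hre1]; simp [w₀]
  have c3 := hmT _ (hmap w₀ c1)
  rw [show w₀ - a + 2 * Real.pi * Complex.I = w₀ + 2 * Real.pi * Complex.I - a by ring] at c3
  have : k w₀ = - k w₀ := by
    rcases h2 with h2 | h2
    · have b1 := h2 c1
      have b2 := h2 c2
      simp only at b1 b2
      rw [c3, b1, hT'] at b2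
      exact b2.symm
    · have b1 := h2 c1
      have b2 := h2 c2
      simp only [Pi.neg_apply] at b1 b2
      rw [c3, b1, hT'] at b2
      simpa using b2
  exact hk0 _ (self_eq_neg.1 this)

/-! ## Charts -/

/-- Every neighborhood of every point contains an open copy of the plane around the point. -/
def HasCharts (S : Type*) [TopologicalSpace S] : Prop :=
  ∀ x : S, ∀ N ∈ 𝓝 x, ∃ e : ℂ → S, IsOpenEmbedding e ∧ e 0 = x ∧ range e ⊆ N

lemma LocallyEuclidean2.hasCharts {S : Type*} [TopologicalSpace S] (hS : LocallyEuclidean2 S) :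
    HasCharts S := by
  intro x N hN
  obtain ⟨U, hU, hxU, ⟨φ⟩⟩ := hS x
  set L := Complex.orthonormalBasisOneI.repr.toHomeomorph
  set e₀ : ℂ → S := fun z => (φ.symm (L z) : S)
  have he₀ : IsOpenEmbedding e₀ :=
    hU.isOpenEmbedding_subtypeVal.comp (φ.symm.isOpenEmbedding.comp L.isOpenEmbedding)
  set a : ℂ := L.symm (φ ⟨x, hxU⟩)
  have ha : e₀ a = x := by simp [e₀, a]
  have hNa : e₀ ⁻¹' N ∈ 𝓝 a := he₀.continuous.continuousAt.preimage_mem_nhds (by rwa [ha])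
  obtain ⟨r, hr, hrN⟩ := Metric.mem_nhds_iff.1 hNa
  set b := OpenPartialHomeomorph.univBall (E := ℂ) a r
  have hb : IsOpenEmbedding b :=
    b.isOpenEmbedding (OpenPartialHomeomorph.univBall_source a r)
  refine ⟨e₀ ∘ b, he₀.comp hb, ?_, ?_⟩
  · simp [b, ha]
  · rintro _ ⟨z, rfl⟩
    apply hrN
    rw [← OpenPartialHomeomorph.univBall_target a hr]
    exact b.map_source (by simp [b])

lemma HasCharts.locallyPathConnectedSpace {S : Type*} [TopologicalSpace S] (hS : HasCharts S) :
    LocallyPathConnectedSpace S where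
  path_connected_basis x := by
    rw [hasBasis_self]
    intro t ht
    obtain ⟨e, he, h0, hr⟩ := hS x t ht
    refine ⟨range e, ?_, isPathConnected_range he.continuous, hr⟩
    exact he.isOpen_range.mem_nhds ⟨0, h0⟩

lemma exists_sqrt_chart {S : Type*} [TopologicalSpace S] {e : ℂ → S} (he : IsOpenEmbedding e)
    {G : S → ℂ} (hG : ContinuousOn G (range e)) (h0 : ∀ x ∈ range e, G x ≠ 0) :
    ∃ k : S → ℂ, ContinuousOn k (range e) ∧ ∀ x ∈ range e, k x ^ 2 = G x := by
  obtain ⟨k, hk, hk2⟩ := exists_sqrt_plane (fun z => G (e z))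
    (hG.comp_continuous he.continuous fun z => ⟨z, rfl⟩) (fun z => h0 _ ⟨z, rfl⟩)
  have hinv : ∀ z, Function.invFun e (e z) = z := Function.leftInverse_invFun he.injective
  refine ⟨fun x => k (Function.invFun e x), ?_, ?_⟩
  · rintro _ ⟨z, rfl⟩
    refine ContinuousAt.continuousWithinAt ?_
    rw [← he.continuousAt_iff]
    have : (fun x => k (Function.invFun e x)) ∘ e = k := by ext z; simp [hinv]
    rw [this]; exact hk.continuousAt
  · rintro _ ⟨z, rfl⟩
    simp only [hinv, hk2]

/-! ## Functions with prescribed branching -/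

/-- There is a nonvanishing function off `{e 0, d}`, trivial off a closed subset of `P`,
and which is a model function in the chart `e` near `e 0`. -/
def Good {S : Type*} [TopologicalSpace S] (P : Set S) (e : ℂ → S) (d : S) : Prop :=
  ∃ G : S → ℂ, (∀ x, x ≠ e 0 → x ≠ d → ContinuousAt G x) ∧
    (∀ x, x ≠ e 0 → x ≠ d → G x ≠ 0) ∧
    (∃ K, IsClosed K ∧ K ⊆ P ∧ ∀ x, x ∉ K → G x = 1) ∧
    ∃ p : ℂ, p ≠ 0 ∧ ∀ᶠ z in 𝓝[≠] (0 : ℂ), G (e z) = model (z / p)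

lemma isClosed_chart_image {S : Type*} [TopologicalSpace S] [T2Space S] {e : ℂ → S}
    (he : IsOpenEmbedding e) (r : ℝ) : IsClosed (e '' closedBall 0 r) :=
  ((isCompact_closedBall 0 r).image he.continuous).isClosed

lemma good_base {S : Type*} [TopologicalSpace S] [T2Space S] {P : Set S} {e : ℂ → S}
    (he : IsOpenEmbedding e) {p : ℂ} (hp : p ≠ 0) (hP : e '' closedBall 0 (2 * ‖p‖) ⊆ P) :
    Good P e (e p) := by
  classical
  have hinv : ∀ z, Function.invFun e (e z) = z := Function.leftInverse_invFun he.injective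
  set G : S → ℂ := fun x => if x ∈ range e then model (Function.invFun e x / p) else 1 with hG
  have hGe : ∀ z, G (e z) = model (z / p) := fun z => by
    simp [hG, hinv]
  have hK := isClosed_chart_image he (2 * ‖p‖)
  have hone : ∀ x, x ∉ e '' closedBall 0 (2 * ‖p‖) → G x = 1 := by
    intro x hx
    by_cases hxr : x ∈ range e
    · obtain ⟨z, rfl⟩ := hxr
      rw [hGe]
      apply model_eq_one
      have : ¬ ‖z‖ ≤ 2 * ‖p‖ := fun h => hx ⟨z, by simpa using h, rfl⟩
      rw [norm_div, le_div_iff₀ (norm_pos_iff.2 hp)]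
      linarith
    · simp only [hG, if_neg hxr]
  refine ⟨G, ?_, ?_, ⟨_, hK, hP, hone⟩, p, hp, Eventually.of_forall hGe⟩
  · intro x hx0 hx1
    by_cases hxr : x ∈ range e
    · obtain ⟨z, rfl⟩ := hxr
      rw [← he.continuousAt_iff]
      have : G ∘ e = fun z => model (z / p) := funext hGe
      rw [this]
      have hz0 : z ≠ 0 := fun h => hx0 (by rw [h])
      have hz1 : z ≠ p := fun h => hx1 (by rw [h])
      refine ContinuousAt.comp (f := fun z : ℂ => z / p) (model_continuousAt ?_ ?_) (by fun_prop)
      · exact div_ne_zero hz0 hp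
      · rwa [Ne, div_eq_one_iff_eq hp]
    · have : G =ᶠ[𝓝 x] fun _ => 1 := by
        filter_upwards [hK.isOpen_compl.mem_nhds (fun h => hxr (image_subset_range _ _ h))]
          with y hy using hone y hy
      exact continuousAt_const.congr this.symm
  · intro x hx0 hx1
    by_cases hxr : x ∈ range e
    · obtain ⟨z, rfl⟩ := hxr
      have hz0 : z ≠ 0 := fun h => hx0 (by rw [h])
      have hz1 : z ≠ p := fun h => hx1 (by rw [h])
      rw [hGe]
      refine model_ne_zero (div_ne_zero hz0 hp) ?_
      rwa [Ne, div_eq_one_iff_eq hp]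
    · simp only [hG, if_neg hxr]; exact one_ne_zero

lemma exists_push (a b : ℂ) (ha : ‖a‖ < 1 / 4) (hb : ‖b‖ < 1 / 4) :
    ∃ ψ : ℂ → ℂ, Continuous ψ ∧ (∀ y, 1 ≤ ‖y‖ → ψ y = y) ∧ ∀ y, ψ y = a → y = b := by
  refine ⟨fun y => y + ((max 0 (1 - ‖y‖) / (1 - ‖b‖) : ℝ) : ℂ) * (a - b), by fun_prop, ?_, ?_⟩
  · intro y hy
    simp only
    rw [max_eq_left (by linarith)]; simp
  · intro y hy
    simp only at hy
    set s : ℝ := max 0 (1 - ‖y‖) / (1 - ‖b‖) with hs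
    have h1 : y - b = ((1 - s : ℝ) : ℂ) * (a - b) := by
      push_cast
      linear_combination hy
    have hb' : 0 < 1 - ‖b‖ := by linarith
    have h2 : |1 - s| ≤ ‖y - b‖ / (1 - ‖b‖) := by
      have : 1 - s = (max 0 (1 - ‖b‖) - max 0 (1 - ‖y‖)) / (1 - ‖b‖) := by
        rw [max_eq_right hb'.le, hs, sub_div, div_self hb'.ne']
      rw [this, abs_div, abs_of_pos hb']
      gcongr
      have e1 := abs_max_sub_max_le_max 0 (1 - ‖b‖) 0 (1 - ‖y‖)
      have e2 := abs_norm_sub_norm_le y b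
      have e3 : (1 - ‖b‖) - (1 - ‖y‖) = ‖y‖ - ‖b‖ := by ring
      have e4 : max |(0 : ℝ) - 0| |(1 - ‖b‖) - (1 - ‖y‖)| ≤ |‖y‖ - ‖b‖| := by
        rw [e3]; exact max_le (by simp) le_rfl
      linarith
    have h3 : ‖y - b‖ = |1 - s| * ‖a - b‖ := by
      rw [h1, norm_mul, Complex.norm_real, Real.norm_eq_abs]
    have h4 : ‖a - b‖ ≤ 1 / 2 := by
      have := norm_sub_le a b
      linarith
    have h5 : ‖y - b‖ = 0 := by
      rw [le_div_iff₀ hb'] at h2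
      have h6 := norm_nonneg (y - b)
      have h7 := abs_nonneg (1 - s)
      have h8 : |1 - s| * (3 / 4) ≤ |1 - s| * (1 - ‖b‖) := by gcongr; linarith
      have h9 : |1 - s| * ‖a - b‖ ≤ |1 - s| * (1 / 2) := by gcongr
      linarith
    exact sub_eq_zero.1 (norm_eq_zero.1 h5)

lemma good_step {S : Type*} [TopologicalSpace S] [T2Space S] {P : Set S} {e j : ℂ → S}
    (he : IsOpenEmbedding e) (hj : IsOpenEmbedding j) (hjP : range j ⊆ P) (hej : e 0 ∉ range j)
    {a b : ℂ} (ha : ‖a‖ < 1 / 4) (hb : ‖b‖ < 1 / 4) (h : Good P e (j a)) : Good P e (j b) := by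
  classical
  obtain ⟨ψ, hψ, hψ1, hψa⟩ := exists_push a b ha hb
  obtain ⟨G, hGc, hG0, ⟨K, hK, hKP, hK1⟩, p, hp, hgerm⟩ := h
  have hinv : ∀ z, Function.invFun j (j z) = z := Function.leftInverse_invFun hj.injective
  set Ψ : S → S := fun x => if x ∈ range j then j (ψ (Function.invFun j x)) else x with hΨ
  have hΨj : ∀ z, Ψ (j z) = j (ψ z) := fun z => by simp [hΨ, hinv]
  have hC := isClosed_chart_image hj 1
  have hid : ∀ x, x ∉ j '' closedBall 0 1 → Ψ x = x := by
    intro x hx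
    by_cases hxr : x ∈ range j
    · obtain ⟨z, rfl⟩ := hxr
      rw [hΨj, hψ1]
      have : ¬ ‖z‖ ≤ 1 := fun h => hx ⟨z, by simpa using h, rfl⟩
      linarith
    · simp only [hΨ, if_neg hxr]
  have hid' : ∀ x, x ∉ j '' closedBall 0 1 → ∀ᶠ y in 𝓝 x, Ψ y = y := fun x hx => by
    filter_upwards [hC.isOpen_compl.mem_nhds hx] with y hy using hid y hy
  have hΨc : Continuous Ψ := by
    rw [continuous_iff_continuousAt]
    intro x
    by_cases hxr : x ∈ range j
    · obtain ⟨z, rfl⟩ := hxr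
      rw [← hj.continuousAt_iff]
      have : Ψ ∘ j = j ∘ ψ := funext hΨj
      rw [this]
      exact (hj.continuous.comp hψ).continuousAt
    · have := hid' x (fun h => hxr (image_subset_range _ _ h))
      exact continuousAt_id.congr (this.mono fun y hy => hy.symm)
  have hne0 : ∀ x, x ≠ e 0 → Ψ x ≠ e 0 := by
    intro x hx hx'
    by_cases hxr : x ∈ range j
    · obtain ⟨z, rfl⟩ := hxr
      rw [hΨj] at hx'
      exact hej ⟨_, hx'⟩
    · simp only [hΨ, if_neg hxr] at hx'
      exact hx hx'
  have hne1 : ∀ x, x ≠ j b → Ψ x ≠ j a := by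
    intro x hx hx'
    by_cases hxr : x ∈ range j
    · obtain ⟨z, rfl⟩ := hxr
      rw [hΨj] at hx'
      exact hx (by rw [hψa z (hj.injective hx')])
    · simp only [hΨ, if_neg hxr] at hx'
      exact hxr ⟨a, hx'.symm⟩
  refine ⟨G ∘ Ψ, ?_, ?_, ⟨K ∪ j '' closedBall 0 1, hK.union hC, ?_, ?_⟩, p, hp, ?_⟩
  · intro x hx0 hx1
    exact (hGc _ (hne0 x hx0) (hne1 x hx1)).comp hΨc.continuousAt
  · intro x hx0 hx1
    exact hG0 _ (hne0 x hx0) (hne1 x hx1)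
  · exact union_subset hKP ((image_subset_range _ _).trans hjP)
  · intro x hx
    rw [mem_union, not_or] at hx
    simp only [Function.comp_apply, hid x hx.2]
    exact hK1 x hx.1
  · have h1 := hid' (e 0) (fun h => hej (image_subset_range _ _ h))
    have h2 : ∀ᶠ z in 𝓝 (0 : ℂ), Ψ (e z) = e z := he.continuous.continuousAt.eventually h1
    filter_upwards [hgerm, h2.filter_mono nhdsWithin_le_nhds] with z hz hz'
    simp only [Function.comp_apply, hz', hz]

lemma good_of_connected {S : Type*} [TopologicalSpace S] [T2Space S] (hS : HasCharts S)
    {P : Set S} (hP : IsOpen P) (hPc : IsPreconnected P) {e : ℂ → S} (he : IsOpenEmbedding e)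
    (heP : e 0 ∈ P) {d : S} (hd : d ∈ P) (hde : d ≠ e 0) : Good P e d := by
  set u : Set S := {x | x = e 0 ∨ (x ∈ P ∧ x ≠ e 0 ∧ Good P e x)} with hu
  have hsmall : (j : ℂ → S) → IsOpenEmbedding j → j '' ball 0 (1 / 4) ∈ 𝓝 (j 0) := fun j hj =>
    (hj.isOpenMap _ isOpen_ball).mem_nhds ⟨0, by simp, rfl⟩
  have hnb : ∀ x ∈ P, x ≠ e 0 → P ∩ {e 0}ᶜ ∈ 𝓝 x := fun x hx hx0 =>
    (hP.inter isOpen_compl_singleton).mem_nhds ⟨hx, hx0⟩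
  have huo : IsOpen u := by
    rw [isOpen_iff_mem_nhds]
    rintro x (rfl | ⟨hxP, hx0, hxG⟩)
    · have : e ⁻¹' P ∈ 𝓝 (0 : ℂ) :=
        he.continuous.continuousAt.preimage_mem_nhds (hP.mem_nhds heP)
      obtain ⟨r, hr, hrP⟩ := Metric.mem_nhds_iff.1 this
      have hmem : e '' ball 0 (r / 3) ∈ 𝓝 (e 0) :=
        (he.isOpenMap _ isOpen_ball).mem_nhds ⟨0, by simp; linarith, rfl⟩
      refine mem_of_superset hmem ?_
      rintro _ ⟨p, hp, rfl⟩
      rw [mem_ball_zero_iff] at hp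
      by_cases hp0 : p = 0
      · left; rw [hp0]
      · right
        refine ⟨hrP (by simp; linarith), fun h => hp0 (he.injective h), good_base he hp0 ?_⟩
        rintro _ ⟨z, hz, rfl⟩
        rw [mem_closedBall_zero_iff] at hz
        exact hrP (by simp; linarith)
    · obtain ⟨j, hj, rfl, hjr⟩ := hS x _ (hnb x hxP hx0)
      refine mem_of_superset (hsmall j hj) ?_
      rintro _ ⟨b, hb, rfl⟩
      have hb' := hjr ⟨b, rfl⟩
      refine Or.inr ⟨hb'.1, hb'.2, good_step he hj (fun y hy => (hjr hy).1)
        (fun h => (hjr h).2 rfl) (a := 0) (by simp) (by simpa using hb) hxG⟩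
  have hsub : P ⊆ u := by
    refine hPc.subset_of_closure_inter_subset huo ⟨e 0, heP, Or.inl rfl⟩ ?_
    rintro x ⟨hxc, hxP⟩
    by_cases hx0 : x = e 0
    · exact Or.inl hx0
    · obtain ⟨j, hj, rfl, hjr⟩ := hS x _ (hnb x hxP hx0)
      obtain ⟨_, ⟨a, ha, rfl⟩, hau⟩ := mem_closure_iff_nhds.1 hxc _ (hsmall j hj)
      rcases hau with h | ⟨-, -, h⟩
      · exact absurd h (hjr ⟨a, rfl⟩).2
      · exact Or.inr ⟨hxP, hx0, good_step he hj (fun y hy => (hjr hy).1)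
          (fun h => (hjr h).2 rfl) (by simpa using ha) (by simp) h⟩
  rcases hsub hd with h | h
  · exact absurd h hde
  · exact h.2.2

/-! ## Finiteness of classes modulo squares -/

lemma sqrt_class_finiteness {S : Type*} [MetricSpace S] (hS : HasCharts S) {C W : Set S} (hW : IsOpen W)
    (hC : IsCompact C) (hCW : C ⊆ W) (G : ℕ → S → ℂ) (hG : ∀ n, ContinuousOn (G n) W)
    (h0 : ∀ n, ∀ x ∈ W, G n x ≠ 0) :
    ∃ I : Set ℕ, I.Infinite ∧ ∀ m ∈ I, ∀ n ∈ I, ∃ h : S → ℂ, ContinuousOn h C ∧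
      ∀ x ∈ C, h x ^ 2 * G n x = G m x := by
  classical
  choose! e he he0 heW using fun x (hx : x ∈ C) => hS x W (hW.mem_nhds (hCW hx))
  obtain ⟨δ, hδ, hleb⟩ := lebesgue_number_lemma_of_metric (ι := C) (c := fun x => range (e x)) hC
    (fun x => (he x x.2).isOpen_range) (fun x hx => mem_iUnion.2 ⟨⟨x, hx⟩, ⟨0, he0 x hx⟩⟩)
  have hsq : ∀ n, ∀ x : C, ∃ k : S → ℂ, ContinuousOn k (ball (x : S) δ) ∧
      (∀ y ∈ ball (x : S) δ, k y ^ 2 = G n y) ∧ ∀ y ∈ ball (x : S) δ, k y ≠ 0 := by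
    intro n x
    obtain ⟨i, hi⟩ := hleb x x.2
    obtain ⟨k, hk, hk2⟩ := exists_sqrt_chart (he i i.2) ((hG n).mono (heW i i.2))
      (fun y hy => h0 n y (heW i i.2 hy))
    refine ⟨k, hk.mono hi, fun y hy => hk2 y (hi hy), fun y hy hy0 => ?_⟩
    have := hk2 y (hi hy)
    rw [hy0] at this
    exact h0 n y (heW i i.2 (hi hy)) (by simpa using this.symm)
  choose r hr hr2 hr0 using hsq
  have hV : ∀ x : C, ∃ V : Set S, IsOpen V ∧ (x : S) ∈ V ∧ IsPreconnected V ∧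
      V ⊆ ball (x : S) (δ / 3) := by
    intro x
    obtain ⟨j, hj, hj0, hjr⟩ := hS x (ball (x : S) (δ / 3)) (ball_mem_nhds _ (by linarith))
    exact ⟨range j, hj.isOpen_range, ⟨0, hj0⟩, isPreconnected_range hj.continuous, hjr⟩
  choose V hVo hxV hVc hVb using hV
  obtain ⟨t, ht⟩ := hC.elim_finite_subcover V hVo (fun x hx => mem_iUnion.2 ⟨⟨x, hx⟩, hxV ⟨x, hx⟩⟩)
  have hVx : ∀ x, V x ⊆ ball (x : S) δ := fun x =>
    (hVb x).trans (ball_subset_ball (by linarith))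
  have hVxy : ∀ x y, (V x ∩ V y).Nonempty → V y ⊆ ball (x : S) δ := by
    rintro x y ⟨z, hzx, hzy⟩ w hw
    have h1 := mem_ball.1 (hVb x hzx)
    have h2 := mem_ball.1 (hVb y hzy)
    have h3 := mem_ball.1 (hVb y hw)
    rw [mem_ball]
    have h4 := dist_triangle w y x
    have h5 := dist_triangle_left (y : S) x z
    linarith
  set σ : ℕ → (t × t → Prop) := fun n q => ∀ z ∈ V q.1 ∩ V q.2, r n q.1 z = r n q.2 z with hσ
  have hneg : ∀ n q, ¬ σ n q → ∀ z ∈ V q.1 ∩ V q.2, r n q.1 z = - r n q.2 z := by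
    rintro n ⟨x, y⟩ hq z hz
    have hsub := hVxy x y ⟨z, hz⟩
    rcases (hVc y).eq_or_eq_neg_of_sq_eq (f := r n x) (g := r n y) ((hr n x).mono hsub)
      ((hr n y).mono (hVx y)) (fun w hw => by
        simp only [Pi.pow_apply, hr2 n x w (hsub hw), hr2 n y w (hVx y hw)])
      (fun {w} hw => hr0 n y w (hVx y hw)) with h | h
    · exact absurd (fun w hw => h hw.2) hq
    · exact h hz.2
  obtain ⟨τ, hτ⟩ := Finite.exists_infinite_fiber σ
  refine ⟨σ ⁻¹' {τ}, Set.infinite_coe_iff.1 hτ, fun m hm n hn => ?_⟩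
  have hmn : σ m = σ n := by
    rw [mem_preimage, mem_singleton_iff] at hm hn
    rw [hm, hn]
  have hch : ∀ z, z ∈ C → ∃ x : t, z ∈ V x := fun z hz => by
    obtain ⟨x, hx⟩ := mem_iUnion.1 (ht hz)
    obtain ⟨hxt, hx⟩ := mem_iUnion.1 hx
    exact ⟨⟨x, hxt⟩, hx⟩
  have hcons : ∀ x y : t, ∀ z ∈ V x ∩ V y, r m x z / r n x z = r m y z / r n y z := by
    intro x y z hz
    by_cases hq : σ m (x, y)
    · have hq' := hq
      rw [hmn] at hq'
      rw [hq z hz, hq' z hz]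
    · have hq' := hq
      rw [hmn] at hq'
      rw [hneg m (x, y) hq z hz, hneg n (x, y) hq' z hz, neg_div_neg_eq]
  set h : S → ℂ := fun z => if hz : ∃ x : t, z ∈ V x then
    r m hz.choose z / r n hz.choose z else 1 with hh
  have hval : ∀ (x : t) z, z ∈ V x → h z = r m x z / r n x z := by
    intro x z hz
    have hex : ∃ x : t, z ∈ V x := ⟨x, hz⟩
    simp only [hh, dif_pos hex]
    exact hcons _ _ z ⟨hex.choose_spec, hz⟩
  refine ⟨h, ?_, ?_⟩
  · intro z hz
    obtain ⟨x, hx⟩ := hch z hz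
    refine ContinuousAt.continuousWithinAt ?_
    have hb : ball (x : S) δ ∈ 𝓝 z := isOpen_ball.mem_nhds (hVx x hx)
    have hc : ContinuousAt (fun w => r m x w / r n x w) z :=
      ((hr m x).continuousAt hb).div ((hr n x).continuousAt hb) (hr0 n x z (hVx x hx))
    refine hc.congr ?_
    filter_upwards [(hVo x).mem_nhds hx] with w hw using (hval x w hw).symm
  · intro z hz
    obtain ⟨x, hx⟩ := hch z hz
    rw [hval x z hx, div_pow, hr2 m x z (hVx x hx), hr2 n x z (hVx x hx)]
    exact div_mul_cancel₀ _ (h0 n z (hCW hz))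

/-! ## The gluing argument -/

/-- A sign-valued function which is one on `Y` is one on `O`, if `O` is joined to `Y` via `D`. -/
lemma sign_eq_one {S : Type*} [TopologicalSpace S] {M K Y O V D : Set S} (hM : IsOpen M)
    (hV : IsOpen V) {h : S → ℂ} (hc : ContinuousOn h M)
    (hsq : ∀ x ∈ M, x ∉ K → h x ^ 2 = 1) (hY : ∀ x ∈ Y, h x = 1)
    (hO : IsPreconnected O) (hOM : O ⊆ M) (hOV : O ⊆ V) (hVK : Disjoint (V ∩ M) K)
    (hD : IsPreconnected D) (hDM : D ⊆ M) (hDO : (D ∩ O).Nonempty) (hDV : ¬ D ⊆ V)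
    (hfr : frontier V ∩ D ⊆ Y) : ∀ x ∈ O, h x = 1 := by
  have hVMsq : ∀ x ∈ V ∩ M, h x ^ 2 = 1 := fun x hx =>
    hsq x hx.2 (fun hxK => Set.disjoint_left.1 hVK hx hxK)
  obtain ⟨q, hqD, hqO⟩ := hDO
  have hconst := hO.eq_one_or_eq_neg_one_of_sq_eq (hc.mono hOM)
    (fun x hx => hVMsq x ⟨hOV hx, hOM hx⟩)
  rcases hconst with hconst | hconst
  · exact fun x hx => hconst hx
  · exfalso
    have hq : h q = -1 := hconst hqO
    set u : Set S := {x | x ∈ V ∩ M ∧ h x ≠ 1} with hu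
    have huo : IsOpen u := by
      rw [isOpen_iff_mem_nhds]
      rintro x ⟨hx, hx1⟩
      have hca := hc.continuousAt (hM.mem_nhds hx.2)
      filter_upwards [(hV.inter hM).mem_nhds hx, hca.eventually_ne hx1] with y hy hy1
        using ⟨hy, hy1⟩
    have hne : (-1 : ℂ) ≠ 1 := by norm_num
    have hsub : D ⊆ u := by
      refine hD.subset_of_closure_inter_subset huo
        ⟨q, hqD, ⟨hOV hqO, hOM hqO⟩, by rw [hq]; exact hne⟩ ?_
      rintro x ⟨hxc, hxD⟩
      have hxM := hDM hxD
      have hx1 : h x = -1 := by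
        have hca := hc.continuousAt (hM.mem_nhds hxM)
        have hmt : MapsTo h u {-1} := by
          rintro y ⟨hy, hy1⟩
          rcases sq_eq_one_iff.1 (hVMsq y hy) with h | h
          · exact absurd h hy1
          · exact h
        have := hca.continuousWithinAt.mem_closure hxc hmt
        simpa using this
      have hxV : x ∈ V := by
        by_contra hxV
        have : x ∈ frontier V := by
          rw [hV.frontier_eq]
          exact ⟨closure_mono (fun y hy => hy.1.1) hxc, hxV⟩
        have := hY x (hfr ⟨this, hxD⟩)
        rw [hx1] at this
        exact hne this
      exact ⟨⟨hxV, hxM⟩, by rw [hx1]; exact hne⟩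
    exact hDV (fun x hx => (hsub hx).1.1)

/-- Gluing. -/
lemma glue {S : Type*} [TopologicalSpace S] {M : Set S} (hM : IsOpen M)
    {K₁ K₂ K₃ : Set S} (hK₁ : IsClosed K₁) (hK₂ : IsClosed K₂) (hK₃ : IsClosed K₃)
    {O₁ O₂ O₃ : Set S} (hO₁ : IsOpen O₁) (hO₂ : IsOpen O₂) (hO₃ : IsOpen O₃)
    (hKO₁ : K₁ ∩ M ⊆ O₁) (hKO₂ : K₂ ∩ M ⊆ O₂) (hKO₃ : K₃ ∩ M ⊆ O₃)
    (h12 : Disjoint O₁ O₂)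
    {G f g : S → ℂ} (hf : ContinuousOn f M) (hg : ContinuousOn g M)
    (hG : ∀ x, x ∉ K₁ → G x = 1)
    (hf2 : ∀ x ∈ M, x ∉ K₂ → f x ^ 2 = G x) (hg2 : ∀ x ∈ M, x ∉ K₃ → g x ^ 2 = G x)
    (hfO : ∀ x ∈ O₃, f x = 1) (hgO : ∀ x ∈ O₂, g x = 1) (hfg : ∀ x ∈ O₁, f x = g x) :
    ∃ k : S → ℂ, ContinuousOn k M ∧ ∀ x ∈ M, k x ^ 2 = G x := by
  classical
  set k : S → ℂ := fun x => if f x = g x then f x else 1 with hk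
  have k1 : ∀ x ∈ O₁, k x = f x := fun x hx => by simp only [hk, if_pos (hfg x hx)]
  have k2 : ∀ x ∈ O₂, k x = 1 := fun x hx => by
    simp only [hk]; split_ifs with h
    · rw [h, hgO x hx]
    · rfl
  have k3 : ∀ x ∈ O₃, k x = 1 := fun x hx => by
    simp only [hk]; split_ifs with h
    · rw [hfO x hx]
    · rfl
  have hn1 : ∀ x ∈ M, x ∉ O₁ → G x = 1 := fun x hx hxO => hG x (fun h => hxO (hKO₁ ⟨h, hx⟩))
  refine ⟨k, ?_, ?_⟩
  · intro x hx
    refine ContinuousAt.continuousWithinAt ?_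
    have hfx := hf.continuousAt (hM.mem_nhds hx)
    have hgx := hg.continuousAt (hM.mem_nhds hx)
    by_cases a1 : x ∈ O₁
    · refine hfx.congr ?_
      filter_upwards [hO₁.mem_nhds a1] with y hy using (k1 y hy).symm
    by_cases a2 : x ∈ O₂
    · refine (continuousAt_const (y := (1 : ℂ))).congr ?_
      filter_upwards [hO₂.mem_nhds a2] with y hy using (k2 y hy).symm
    by_cases a3 : x ∈ O₃
    · refine (continuousAt_const (y := (1 : ℂ))).congr ?_
      filter_upwards [hO₃.mem_nhds a3] with y hy using (k3 y hy).symm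
    have hev : ∀ᶠ y in 𝓝 x, y ∈ M ∧ y ∉ K₁ ∧ y ∉ K₂ ∧ y ∉ K₃ := by
      filter_upwards [hM.mem_nhds hx, hK₁.isOpen_compl.mem_nhds fun h => a1 (hKO₁ ⟨h, hx⟩),
        hK₂.isOpen_compl.mem_nhds fun h => a2 (hKO₂ ⟨h, hx⟩),
        hK₃.isOpen_compl.mem_nhds fun h => a3 (hKO₃ ⟨h, hx⟩)] with y b1 b2 b3 b4
        using ⟨b1, b2, b3, b4⟩
    have loc : ∀ φ : S → ℂ, ContinuousAt φ x → (∀ᶠ y in 𝓝 x, φ y ^ 2 = 1) →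
        ∀ᶠ y in 𝓝 x, φ y = φ x := by
      intro φ hφ hφ2
      have hx2 := hφ2.self_of_nhds
      have hx0 : φ x ≠ 0 := fun h => by rw [h] at hx2; norm_num at hx2
      have hxn : φ x ≠ - φ x := fun h => hx0 (self_eq_neg.1 h)
      filter_upwards [hφ2, hφ.eventually_ne hxn] with y hy hy1
      rcases sq_eq_sq_iff_eq_or_eq_neg.1 (hy.trans hx2.symm) with h | h
      · exact h
      · exact absurd h hy1
    have lf := loc f hfx (hev.mono fun y hy => by rw [hf2 y hy.1 hy.2.2.1, hG y hy.2.1])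
    have lg := loc g hgx (hev.mono fun y hy => by rw [hg2 y hy.1 hy.2.2.2, hG y hy.2.1])
    refine (continuousAt_const (y := k x)).congr ?_
    filter_upwards [lf, lg] with y hy hy'
    simp only [hk, hy, hy']
  · intro x hx
    by_cases a1 : x ∈ O₁
    · rw [k1 x a1]
      exact hf2 x hx fun h => Set.disjoint_left.1 h12 a1 (hKO₂ ⟨h, hx⟩)
    rw [hn1 x hx a1]
    by_cases a2 : x ∈ O₂
    · rw [k2 x a2]; norm_num
    simp only [hk]
    split_ifs
    · rw [hf2 x hx fun h => a2 (hKO₂ ⟨h, hx⟩), hn1 x hx a1]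
    · norm_num

/-! ## The core argument -/

/-- Attaching a component to a disk through a boundary point. -/
lemma exists_link {S : Type*} [TopologicalSpace S] {e : ℂ → S} (he : IsOpenEmbedding e)
    {E U : Set S} (hE : Disjoint (range e) E) (hU : IsOpen U) {q x : S}
    (hxU : x ∈ U) (hxD : x ∈ e '' closedBall 0 1)
    (hxc : x ∈ closure (connectedComponentIn (U \ (e '' closedBall 0 1 ∪ E)) q)) :
    ∃ N : Set S, IsOpen N ∧ IsPreconnected N ∧ (N ∩ e '' ball 0 1).Nonempty ∧
      (N ∩ connectedComponentIn (U \ (e '' closedBall 0 1 ∪ E)) q).Nonempty ∧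
      N \ (e '' closedBall 0 1 ∪ E) ⊆ connectedComponentIn (U \ (e '' closedBall 0 1 ∪ E)) q := by
  set D := e '' closedBall (0 : ℂ) 1 with hD
  set O := connectedComponentIn (U \ (D ∪ E)) q with hO
  have hOs : O ⊆ U \ (D ∪ E) := connectedComponentIn_subset _ _
  obtain ⟨z0, hz0, rfl⟩ := hxD
  have hz1 : ‖z0‖ = 1 := by
    refine le_antisymm (by simpa using hz0) ?_
    by_contra hlt
    push Not at hlt
    have ho : IsOpen (e '' ball (0 : ℂ) 1) := he.isOpenMap _ isOpen_ball
    obtain ⟨y, hy, hyO⟩ := mem_closure_iff.1 hxc _ ho ⟨z0, by simpa using hlt, rfl⟩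
    exact (hOs hyO).2 (Or.inl (image_mono ball_subset_closedBall hy))
  have hz00 : z0 ≠ 0 := fun h => by simp [h] at hz1
  obtain ⟨w0, hw0⟩ : ∃ w, Complex.exp w = z0 := ⟨_, Complex.exp_log hz00⟩
  have hre : w0.re = 0 := by
    have := Complex.norm_exp w0
    rw [hw0, hz1] at this
    exact (Real.exp_eq_one_iff _).1 this.symm
  set f : ℂ → S := fun w => e (Complex.exp w) with hf
  have hfc : Continuous f := he.continuous.comp Complex.continuous_exp
  have hfo : IsOpenMap f := he.isOpenMap.comp Complex.isOpenMap_exp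
  have hfw : f w0 = e z0 := by simp only [hf, hw0]
  obtain ⟨ε, hε, hεU⟩ := Metric.isOpen_iff.1 (hU.preimage hfc) w0
    (by rw [mem_preimage, hfw]; exact hxU)
  have hNo : IsOpen (f '' ball w0 ε) := hfo _ isOpen_ball
  have hfD : ∀ w, f w ∈ D ↔ w.re ≤ 0 := by
    intro w
    simp only [hD, hf, he.injective.mem_set_image, mem_closedBall_zero_iff, Complex.norm_exp,
      Real.exp_le_one_iff]
  have hNO : (f '' ball w0 ε ∩ O).Nonempty :=
    mem_closure_iff.1 hxc _ hNo ⟨w0, mem_ball_self hε, hfw⟩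
  refine ⟨f '' ball w0 ε, hNo, ((convex_ball w0 ε).isPreconnected).image _ hfc.continuousOn,
    ?_, hNO, ?_⟩
  · refine ⟨f (w0 - (ε / 2 : ℝ)), ⟨_, ?_, rfl⟩, ⟨_, ?_, rfl⟩⟩
    · rw [mem_ball, dist_eq_norm, sub_sub_cancel_left, norm_neg, Complex.norm_real,
        Real.norm_of_nonneg (by positivity)]
      linarith
    · rw [mem_ball_zero_iff, Complex.norm_exp, Real.exp_lt_one_iff]
      simp [hre, hε]
  · have hpc : IsPreconnected (f '' (ball w0 ε ∩ {w | 0 < w.re})) :=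
      (((convex_ball w0 ε).inter (convex_halfSpace_re_gt 0)).isPreconnected).image _
        hfc.continuousOn
    have hsub : f '' (ball w0 ε ∩ {w | 0 < w.re}) ⊆ U \ (D ∪ E) := by
      rintro _ ⟨w, ⟨hw, hw0⟩, rfl⟩
      refine ⟨hεU hw, ?_⟩
      rintro (h | h)
      · exact absurd ((hfD w).1 h) (not_le.2 hw0)
      · exact Set.disjoint_left.1 hE ⟨_, rfl⟩ h
    obtain ⟨_, ⟨w, hw, rfl⟩, hyO⟩ := hNO
    have hwr : 0 < w.re := by
      by_contra h
      exact (hOs hyO).2 (Or.inl ((hfD w).2 (not_lt.1 h)))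
    have key := hpc.subset_connectedComponentIn (mem_image_of_mem f ⟨hw, hwr⟩) hsub
    rw [← connectedComponentIn_eq hyO] at key
    rintro _ ⟨⟨v, hv, rfl⟩, hvD⟩
    refine key ⟨v, ⟨hv, ?_⟩, rfl⟩
    by_contra h
    exact hvD (Or.inl ((hfD v).2 (not_lt.1 h)))

/-- The set `P` built from a path. -/
lemma exists_P {S : Type*} [TopologicalSpace S] [T2Space S] (hS : HasCharts S) {e₁ e₃ : ℂ → S}
    (he₁ : IsOpenEmbedding e₁) (he₃ : IsOpenEmbedding e₃) (hdisj : Disjoint (range e₁) (range e₃))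
    {U D : Set S} (hU : IsOpen U) {γ : ℝ → S} {s u t : ℝ} (hsu : s < u) (hut : u < t)
    (hγ : ContinuousOn γ (Icc s t)) (hγU : ∀ r ∈ Icc s t, γ r ∈ U)
    (hs : γ s ∈ e₁ '' closedBall 0 1) (ht : γ t ∈ e₃ '' closedBall 0 1)
    (hinter : ∀ r ∈ Ioo s t, γ r ∉ e₁ '' closedBall 0 1 ∪ e₃ '' closedBall 0 1)
    (huD : γ u ∈ D) :
    ∃ O P : Set S, IsOpen O ∧ IsPreconnected O ∧
      O ⊆ U \ (e₁ '' closedBall 0 1 ∪ e₃ '' closedBall 0 1) ∧ (D ∩ O).Nonempty ∧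
      IsOpen P ∧ IsPreconnected P ∧ e₁ 0 ∈ P ∧ e₃ 0 ∈ P ∧
      P \ (e₁ '' closedBall 0 1 ∪ e₃ '' closedBall 0 1) ⊆ O := by
  have := hS.locallyPathConnectedSpace
  set D₁ := e₁ '' closedBall (0 : ℂ) 1 with hD₁
  set D₃ := e₃ '' closedBall (0 : ℂ) 1 with hD₃
  have hc₁ : IsClosed D₁ := isClosed_chart_image he₁ 1
  have hc₃ : IsClosed D₃ := isClosed_chart_image he₃ 1
  set O := connectedComponentIn (U \ (D₁ ∪ D₃)) (γ u) with hO
  have hOo : IsOpen O := (hU.sdiff (hc₁.union hc₃)).connectedComponentIn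
  have hOpc : IsPreconnected O := isPreconnected_connectedComponentIn
  have hOs : O ⊆ U \ (D₁ ∪ D₃) := connectedComponentIn_subset _ _
  have hγO : γ '' Ioo s t ⊆ O := by
    refine (isPreconnected_Ioo.image _ (hγ.mono Ioo_subset_Icc_self)).subset_connectedComponentIn
      ⟨u, ⟨hsu, hut⟩, rfl⟩ ?_
    rintro _ ⟨r, hr, rfl⟩
    exact ⟨hγU r (Ioo_subset_Icc_self hr), hinter r hr⟩
  have hst : s < t := hsu.trans hut
  have hcl : ∀ r ∈ Icc s t, γ r ∈ closure O := by
    intro r hr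
    have h1 : r ∈ closure (Ioo s t) := by rw [closure_Ioo hst.ne]; exact hr
    exact ((hγ r hr).mono Ioo_subset_Icc_self).mem_closure h1
      (fun y hy => hγO (mem_image_of_mem _ hy))
  have hd13 : Disjoint (range e₁) D₃ := hdisj.mono_right (image_subset_range _ _)
  have hd31 : Disjoint (range e₃) D₁ := hdisj.symm.mono_right (image_subset_range _ _)
  obtain ⟨N₁, o1, c1, m1, n1, k1⟩ := exists_link (q := γ u) he₁ hd13 hU
    (hγU s (left_mem_Icc.2 hst.le)) hs (hcl s (left_mem_Icc.2 hst.le))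
  have hcl3 := hcl t (right_mem_Icc.2 hst.le)
  rw [hO, union_comm] at hcl3
  obtain ⟨N₃, o3, c3, m3, n3, k3⟩ := exists_link (q := γ u) he₃ hd31 hU
    (hγU t (right_mem_Icc.2 hst.le)) ht hcl3
  rw [← hD₃, union_comm D₃ D₁, ← hO] at n3 k3
  rw [← hD₁, ← hO] at n1 k1
  have hB₁ : IsPreconnected (e₁ '' ball (0 : ℂ) 1) :=
    ((convex_ball _ _).isPreconnected).image _ he₁.continuous.continuousOn
  have hB₃ : IsPreconnected (e₃ '' ball (0 : ℂ) 1) :=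
    ((convex_ball _ _).isPreconnected).image _ he₃.continuous.continuousOn
  have hb₁ : e₁ '' ball (0 : ℂ) 1 ⊆ D₁ := image_mono ball_subset_closedBall
  have hb₃ : e₃ '' ball (0 : ℂ) 1 ⊆ D₃ := image_mono ball_subset_closedBall
  have q1 : IsPreconnected (N₁ ∪ e₁ '' ball (0 : ℂ) 1) := c1.union' m1 hB₁
  have q3 : IsPreconnected (N₃ ∪ e₃ '' ball (0 : ℂ) 1) := c3.union' m3 hB₃
  have q13 : IsPreconnected (O ∪ (N₁ ∪ e₁ '' ball (0 : ℂ) 1)) := by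
    obtain ⟨y, hy, hyO⟩ := n1
    exact hOpc.union' ⟨y, hyO, Or.inl hy⟩ q1
  have q : IsPreconnected (O ∪ (N₁ ∪ e₁ '' ball (0 : ℂ) 1) ∪ (N₃ ∪ e₃ '' ball (0 : ℂ) 1)) := by
    obtain ⟨y, hy, hyO⟩ := n3
    exact q13.union' ⟨y, Or.inl hyO, Or.inl hy⟩ q3
  refine ⟨O, _, hOo, hOpc, hOs, ⟨γ u, huD, hγO ⟨u, ⟨hsu, hut⟩, rfl⟩⟩, ?_, q, ?_, ?_, ?_⟩
  · exact (hOo.union (o1.union (he₁.isOpenMap _ isOpen_ball))).union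
      (o3.union (he₃.isOpenMap _ isOpen_ball))
  · exact Or.inl (Or.inr (Or.inr ⟨0, by simp, rfl⟩))
  · exact Or.inr (Or.inr ⟨0, by simp, rfl⟩)
  · rintro x ⟨((hx | hx | hx) | hx | hx), hxD⟩
    · exact hx
    · exact k1 ⟨hx, hxD⟩
    · exact absurd (Or.inl (hb₁ hx)) hxD
    · exact k3 ⟨hx, hxD⟩
    · exact absurd (Or.inr (hb₃ hx)) hxD

/-- The core contradiction. -/
lemma core {S : Type*} [MetricSpace S] [CompactSpace S] (hS : HasCharts S) {e₁ e₃ : ℂ → S}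
    (he₁ : IsOpenEmbedding e₁) (he₃ : IsOpenEmbedding e₃) (hdisj : Disjoint (range e₁) (range e₃))
    {D Y : Set S} (hD : IsPreconnected D) (hDM : D ⊆ (e₁ '' closedBall 0 1 ∪ e₃ '' closedBall 0 1)ᶜ)
    (hY : IsPreconnected Y) (hYM : Y ⊆ (e₁ '' closedBall 0 1 ∪ e₃ '' closedBall 0 1)ᶜ)
    {U O P : ℕ → Set S} (hU : ∀ n, IsOpen (U n)) (hUd : ∀ m n, m ≠ n → Disjoint (U m) (U n))
    (hYU : ∀ n, Disjoint Y (U n)) (hfr : ∀ n, frontier (U n) ∩ D ⊆ Y)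
    (hO : ∀ n, IsOpen (O n)) (hOc : ∀ n, IsPreconnected (O n))
    (hOU : ∀ n, O n ⊆ U n \ (e₁ '' closedBall 0 1 ∪ e₃ '' closedBall 0 1))
    (hDO : ∀ n, (D ∩ O n).Nonempty) (hP : ∀ n, IsOpen (P n)) (hPc : ∀ n, IsPreconnected (P n))
    (hP1 : ∀ n, e₁ 0 ∈ P n) (hP3 : ∀ n, e₃ 0 ∈ P n)
    (hPO : ∀ n, P n \ (e₁ '' closedBall 0 1 ∪ e₃ '' closedBall 0 1) ⊆ O n) : False := by
  have hne : e₃ 0 ≠ e₁ 0 := fun h =>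
    Set.disjoint_left.1 hdisj ⟨0, rfl⟩ (by rw [← h]; exact ⟨0, rfl⟩)
  have hgood := fun n => good_of_connected hS (hP n) (hPc n) he₁ (hP1 n) (hP3 n) hne
  choose G hGc hG0 hK hgerm using hgood
  choose K hKc hKP hGK using hK
  set D₁ := e₁ '' closedBall (0 : ℂ) 1 with hD₁
  set D₃ := e₃ '' closedBall (0 : ℂ) 1 with hD₃
  have hc₁ : IsClosed D₁ := isClosed_chart_image he₁ 1
  have hc₃ : IsClosed D₃ := isClosed_chart_image he₃ 1
  set M := (D₁ ∪ D₃)ᶜ with hM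
  have hMo : IsOpen M := (hc₁.union hc₃).isOpen_compl
  have hKO : ∀ n, K n ∩ M ⊆ O n := fun n x hx => hPO n ⟨hKP n hx.1, hx.2⟩
  have hOM : ∀ n, O n ⊆ M := fun n x hx => (hOU n hx).2
  have hOV : ∀ n, O n ⊆ U n := fun n x hx => (hOU n hx).1
  have hYK : ∀ n, ∀ x ∈ Y, x ∉ K n := fun n x hx hxK =>
    Set.disjoint_left.1 (hYU n) hx (hOV n (hKO n ⟨hxK, hYM hx⟩))
  have hM1 : ∀ x ∈ M, x ≠ e₁ 0 ∧ x ≠ e₃ 0 := by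
    intro x hx
    constructor
    · rintro rfl; exact hx (Or.inl ⟨0, by simp, rfl⟩)
    · rintro rfl; exact hx (Or.inr ⟨0, by simp, rfl⟩)
  -- the compact set
  set B := e₁ '' ball (0 : ℂ) 1 ∪ e₃ '' ball (0 : ℂ) 1 with hB
  have hBo : IsOpen B := (he₁.isOpenMap _ isOpen_ball).union (he₃.isOpenMap _ isOpen_ball)
  have hMB : M ⊆ Bᶜ := compl_subset_compl.2
    (union_subset_union (image_mono ball_subset_closedBall) (image_mono ball_subset_closedBall))
  obtain ⟨I, hI, hIh⟩ := sqrt_class_finiteness hS (C := Bᶜ) (W := {e₁ 0, e₃ 0}ᶜ)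
    (Set.toFinite _).isClosed.isOpen_compl hBo.isClosed_compl.isCompact
    (compl_subset_compl.2 (by
      rintro x (rfl | rfl)
      · exact Or.inl ⟨0, by simp, rfl⟩
      · exact Or.inr ⟨0, by simp, rfl⟩)) G
    (fun n x hx => by
      simp only [mem_compl_iff, mem_insert_iff, mem_singleton_iff, not_or] at hx
      exact (hGc n x hx.1 hx.2).continuousWithinAt)
    (fun n x hx => by
      simp only [mem_compl_iff, mem_insert_iff, mem_singleton_iff, not_or] at hx
      exact hG0 n x hx.1 hx.2)
  have pair : ∀ m ∈ I, ∀ n ∈ I, ∃ h : S → ℂ, ContinuousOn h M ∧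
      (∀ x ∈ M, h x ^ 2 * G n x = G m x) ∧ ∀ x ∈ Y, h x = 1 := by
    intro m hm n hn
    obtain ⟨h, hhc, hh⟩ := hIh m hm n hn
    have hsq : ∀ x ∈ Y, h x ^ 2 = 1 := by
      intro x hx
      have := hh x (hMB (hYM hx))
      rwa [hGK n x (hYK n x hx), hGK m x (hYK m x hx), mul_one] at this
    rcases hY.eq_one_or_eq_neg_one_of_sq_eq ((hhc.mono hMB).mono hYM) hsq with h1 | h1
    · exact ⟨h, hhc.mono hMB, fun x hx => hh x (hMB hx), fun x hx => h1 hx⟩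
    · refine ⟨fun x => - h x, (hhc.mono hMB).neg, fun x hx => ?_, fun x hx => ?_⟩
      · rw [neg_sq]; exact hh x (hMB hx)
      · have : h x = -1 := h1 hx
        show - h x = 1
        rw [this, neg_neg]
  have sgn : ∀ l m n, l ≠ m → l ≠ n → ∀ h : S → ℂ, ContinuousOn h M →
      (∀ x ∈ M, x ∉ K m → x ∉ K n → h x ^ 2 = 1) → (∀ x ∈ Y, h x = 1) → ∀ x ∈ O l, h x = 1 := by
    intro l m n hlm hln h hhc hh hhY
    have hout : ∀ j, l ≠ j → ∀ x ∈ U l, x ∉ O j := fun j hj x hx hxj =>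
      Set.disjoint_left.1 (hUd l j hj) hx (hOV j hxj)
    refine sign_eq_one (K := K m ∪ K n) hMo (hU l) hhc
      (fun x hx hxK => hh x hx (fun h => hxK (Or.inl h)) (fun h => hxK (Or.inr h))) hhY
      (hOc l) (hOM l) (hOV l) ?_ hD hDM (hDO l) ?_ (hfr l)
    · rw [Set.disjoint_left]
      rintro x ⟨hxU, hxM⟩ (hx | hx)
      · exact hout m hlm x hxU (hKO m ⟨hx, hxM⟩)
      · exact hout n hln x hxU (hKO n ⟨hx, hxM⟩)
    · intro hsub
      obtain ⟨y, hyD, hyO⟩ := hDO m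
      exact hout m hlm y (hsub hyD) hyO
  obtain ⟨a, ha⟩ := hI.nonempty
  obtain ⟨b, hb, hab⟩ := hI.exists_notMem_finset {a}
  obtain ⟨c, hc, hac⟩ := hI.exists_notMem_finset {a, b}
  simp only [Finset.mem_singleton, Finset.mem_insert, not_or] at hab hac
  obtain ⟨f, hfc, hf, hfY⟩ := pair a ha b hb
  obtain ⟨g, hgc, hg, hgY⟩ := pair a ha c hc
  have hG0M : ∀ n, ∀ x ∈ M, G n x ≠ 0 := fun n x hx => hG0 n x (hM1 x hx).1 (hM1 x hx).2
  have hg0 : ∀ x ∈ M, g x ≠ 0 := fun x hx h0 => by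
    have := hg x hx
    rw [h0] at this
    exact hG0M a x hx (by simpa using this.symm)
  have hf1 := sgn c a b hac.1 hac.2 f hfc (fun x hx h1 h2 => by
    have := hf x hx
    rwa [hGK b x h2, hGK a x h1, mul_one] at this) hfY
  have hg1 := sgn b a c hab (Ne.symm hac.2) g hgc (fun x hx h1 h2 => by
    have := hg x hx
    rwa [hGK c x h2, hGK a x h1, mul_one] at this) hgY
  have hfg := sgn a b c (Ne.symm hab) (Ne.symm hac.1) (fun x => f x / g x) (hfc.div hgc hg0)
    (fun x hx h1 h2 => by
      have e1 := hf x hx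
      have e2 := hg x hx
      rw [hGK b x h1, mul_one] at e1
      rw [hGK c x h2, mul_one] at e2
      rw [div_pow, e1, e2, div_self (hG0M a x hx)])
    (fun x hx => by rw [hfY x hx, hgY x hx, div_one])
  obtain ⟨k, hkc, hk⟩ := glue hMo (hKc a) (hKc b) (hKc c) (hO a) (hO b) (hO c) (hKO a) (hKO b)
    (hKO c) ((hUd a b (Ne.symm hab)).mono (hOV a) (hOV b)) hfc hgc (hGK a)
    (fun x hx h => by
      have := hf x hx
      rwa [hGK b x h, mul_one] at this)
    (fun x hx h => by
      have := hg x hx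
      rwa [hGK c x h, mul_one] at this) hf1 hg1
    (fun x hx => (div_eq_one_iff_eq (hg0 x (hOM a hx))).1 (hfg x hx))
  have hoff : ∀ z, e₁ z ≠ e₃ 0 := fun z h =>
    Set.disjoint_left.1 hdisj ⟨z, rfl⟩ (by rw [h]; exact ⟨0, rfl⟩)
  have hoff0 : ∀ z, z ≠ 0 → e₁ z ≠ e₁ 0 := fun z hz h => hz (he₁.injective h)
  have hmap : MapsTo e₁ (closedBall (0 : ℂ) 1)ᶜ M := by
    rintro z hz (h | h)
    · exact hz ((he₁.injective.mem_set_image).1 h)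
    · exact Set.disjoint_left.1 hdisj ⟨z, rfl⟩ (image_subset_range _ _ h)
  obtain ⟨p, hp, hpg⟩ := hgerm a
  exact no_sqrt (fun z => G a (e₁ z))
    (fun z hz => ((hGc a _ (hoff0 z hz) (hoff z)).comp
      he₁.continuous.continuousAt).continuousWithinAt)
    (fun z hz => hG0 a _ (hoff0 z hz) (hoff z)) p hp hpg (fun z => k (e₁ z))
    (hkc.comp he₁.continuous.continuousOn hmap) (fun z hz => hk _ (hmap hz))

/-! ## Reduction to the core argument -/

/-- Three disjoint compact sets of reals: a minimal configuration. -/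
lemma exists_sorted (T : Fin 3 → Set ℝ) (hT : ∀ i, IsCompact (T i)) (hne : ∀ i, (T i).Nonempty)
    (hd : ∀ i j, i ≠ j → Disjoint (T i) (T j)) :
    ∃ σ : Equiv.Perm (Fin 3), ∃ s u t : ℝ, s ∈ T (σ 0) ∧ u ∈ T (σ 1) ∧ t ∈ T (σ 2) ∧
      s < u ∧ u < t ∧ ∀ r ∈ Ioo s t, r ∉ T (σ 0) ∧ r ∉ T (σ 2) := by
  set φ : (Fin 3 → ℝ) → ℝ := fun x => ∑ i, ∑ j, |x i - x j| with hφ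
  have hφc : Continuous φ := by fun_prop
  have hφσ : ∀ x, ∀ σ : Equiv.Perm (Fin 3), φ (x ∘ σ) = φ x := by
    intro x σ
    simp only [hφ, Function.comp_apply]
    rw [Equiv.sum_comp σ (fun i => ∑ j, |x i - x (σ j)|)]
    refine Finset.sum_congr rfl fun i _ => ?_
    exact Equiv.sum_comp σ (fun j => |x i - x j|)
  obtain ⟨x, hx, hmin⟩ := (isCompact_univ_pi hT).exists_isMinOn
    (univ_pi_nonempty_iff.2 hne) hφc.continuousOn
  have hxT : ∀ i, x i ∈ T i := fun i => hx i (mem_univ i)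
  have hxi : Function.Injective x := by
    intro i j hij
    by_contra h
    exact Set.disjoint_left.1 (hd i j h) (hxT i) (by rw [hij]; exact hxT j)
  set σ : Equiv.Perm (Fin 3) := Tuple.sort x with hσ
  have hmono : StrictMono (x ∘ σ) :=
    (Tuple.monotone_sort x).strictMono_of_injective (hxi.comp σ.injective)
  have h01 : x (σ 0) < x (σ 1) := hmono (by decide)
  have h12 : x (σ 1) < x (σ 2) := hmono (by decide)
  have key : ∀ z : Fin 3 → ℝ, (∀ i, z i ∈ T (σ i)) → φ (x ∘ σ) ≤ φ z := by
    intro z hz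
    have h1 : φ (z ∘ σ.symm) = φ z := hφσ z σ.symm
    rw [hφσ, ← h1]
    refine hmin ?_
    intro i _
    have := hz (σ.symm i)
    simpa using this
  have hval : ∀ a b c : ℝ, φ ![a, b, c] = 2 * (|a - b| + |b - c| + |c - a|) := by
    intro a b c
    simp only [hφ, Fin.sum_univ_three, Matrix.cons_val_zero, Matrix.cons_val_one, Matrix.cons_val,
      sub_self, abs_zero]
    rw [abs_sub_comm b a, abs_sub_comm c b, abs_sub_comm a c]
    ring
  have hxv : x ∘ σ = ![x (σ 0), x (σ 1), x (σ 2)] := by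
    ext i; fin_cases i <;> rfl
  rw [hxv] at key
  refine ⟨σ, x (σ 0), x (σ 1), x (σ 2), hxT _, hxT _, hxT _, h01, h12, ?_⟩
  rintro r ⟨hr1, hr2⟩
  constructor
  · intro hr
    have := key ![r, x (σ 1), x (σ 2)] (by
      intro i; fin_cases i
      · exact hr
      · exact hxT _
      · exact hxT _)
    rw [hval, hval] at this
    rw [abs_of_neg (sub_neg.2 h01), abs_of_neg (sub_neg.2 h12),
      abs_of_pos (sub_pos.2 (h01.trans h12)), abs_of_pos (sub_pos.2 hr2)] at this
    rcases abs_cases (r - x (σ 1)) with h | h <;> linarith [h.1, h.2]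
  · intro hr
    have := key ![x (σ 0), x (σ 1), r] (by
      intro i; fin_cases i
      · exact hxT _
      · exact hxT _
      · exact hr)
    rw [hval, hval] at this
    rw [abs_of_neg (sub_neg.2 h01), abs_of_neg (sub_neg.2 h12),
      abs_of_pos (sub_pos.2 (h01.trans h12)), abs_of_pos (sub_pos.2 hr1)] at this
    rcases abs_cases (x (σ 1) - r) with h | h <;> linarith [h.1, h.2]

lemma compl_domain_props {S : Type*} [TopologicalSpace S] [LocallyConnectedSpace S] {X U : Set S}
    (hX : IsClosed X) (hU : IsComplementaryDomain X U) :
    IsOpen U ∧ IsConnected U ∧ U ⊆ Xᶜ ∧ frontier U ⊆ X := by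
  obtain ⟨x, hx, rfl⟩ := hU
  have ho : IsOpen (connectedComponentIn Xᶜ x) := hX.isOpen_compl.connectedComponentIn
  refine ⟨ho, isConnected_connectedComponentIn_iff.2 hx, connectedComponentIn_subset _ _, ?_⟩
  intro y hy
  by_contra hyX
  rw [ho.frontier_eq] at hy
  obtain ⟨z, hz1, hz2⟩ := mem_closure_iff.1 hy.1 (connectedComponentIn Xᶜ y)
    hX.isOpen_compl.connectedComponentIn (mem_connectedComponentIn hyX)
  apply hy.2
  rw [connectedComponentIn_eq hz2, ← connectedComponentIn_eq hz1]
  exact mem_connectedComponentIn hyX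

lemma compl_domain_disjoint {S : Type*} [TopologicalSpace S] {X U V : Set S}
    (hU : IsComplementaryDomain X U) (hV : IsComplementaryDomain X V) (hne : U ≠ V) :
    Disjoint U V := by
  obtain ⟨x, hx, rfl⟩ := hU
  obtain ⟨y, hy, rfl⟩ := hV
  rw [Set.disjoint_left]
  intro z h1 h2
  exact hne ((connectedComponentIn_eq h1).trans (connectedComponentIn_eq h2).symm)

lemma not_three {S : Type*} [MetricSpace S] [CompactSpace S] [ConnectedSpace S]
    (hS : HasCharts S) {X : Set S} (hX : IsClosed X) {A : Fin 3 → Set S}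
    (hAc : ∀ i, IsClosed (A i)) (hAp : ∀ i, IsPreconnected (A i))
    (hAX : ⋃ i, A i = X) {x : Fin 3 → S} (hx : ∀ i, x i ∈ A i) (hxn : ∀ i j, i ≠ j → x i ∉ A j)
    (U : ℕ → Set S) (hU : ∀ n, IsComplementaryDomain X (U n))
    (hdistinct : ∀ m n, m ≠ n → U m ≠ U n)
    (hconv : HausdorffConvergesTo (fun n => frontier (U n)) X) : False := by
  have := hS.locallyPathConnectedSpace
  have hUo := fun n => (compl_domain_props hX (hU n)).1
  have hUc := fun n => (compl_domain_props hX (hU n)).2.1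
  have hUX := fun n => (compl_domain_props hX (hU n)).2.2.1
  have hUf := fun n => (compl_domain_props hX (hU n)).2.2.2
  have hxi : Function.Injective x := by
    intro i j hij
    by_contra h
    exact hxn i j h (by rw [hij]; exact hx j)
  have hxX : ∀ i, x i ∈ X := fun i => hAX ▸ mem_iUnion.2 ⟨i, hx i⟩
  -- charts
  obtain ⟨N, hN, hNd⟩ := (Set.finite_range x).t2_separation
  have hN' : ∀ i, N (x i) ∩ ⋂ j, ⋂ (_ : i ≠ j), (A j)ᶜ ∈ 𝓝 (x i) := by
    intro i
    refine IsOpen.mem_nhds ((hN (x i)).2.inter (isOpen_iInter_of_finite fun j =>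
      isOpen_iInter_of_finite fun _ => (hAc j).isOpen_compl)) ⟨(hN (x i)).1, ?_⟩
    simp only [mem_iInter]
    exact fun j hj => hxn i j hj
  choose e he he0 heN using fun i => hS (x i) _ (hN' i)
  have hed : ∀ i j, i ≠ j → Disjoint (range (e i)) (range (e j)) := fun i j hij =>
    (hNd ⟨i, rfl⟩ ⟨j, rfl⟩ (fun h => hij (hxi h))).mono
      ((heN i).trans inter_subset_left) ((heN j).trans inter_subset_left)
  have heA : ∀ i j, i ≠ j → Disjoint (range (e i)) (A j) := by
    intro i j hij
    rw [Set.disjoint_left]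
    intro y hy hyA
    have := (heN i hy).2
    simp only [mem_iInter] at this
    exact this j hij hyA
  -- domains meet the disks
  have hfn : ∀ n, (frontier (U n)).Nonempty := by
    intro n
    rw [nonempty_frontier_iff]
    refine ⟨(hUc n).nonempty, fun h => ?_⟩
    exact hUX n (h ▸ mem_univ (x 0)) (hxX 0)
  have hev : ∀ i, ∀ᶠ n in atTop, (U n ∩ e i '' ball 0 1).Nonempty := by
    intro i
    have ho : IsOpen (e i '' ball (0 : ℂ) 1) := (he i).isOpenMap _ isOpen_ball
    obtain ⟨r, hr, hrB⟩ := Metric.isOpen_iff.1 ho (x i) ⟨0, by simp, he0 i⟩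
    filter_upwards [hconv.eventually (gt_mem_nhds hr)] with n hn
    obtain ⟨z, hz, hzr⟩ := exists_dist_lt_of_hausdorffDist_lt' (hxX i) hn
      (hausdorffEDist_ne_top_of_nonempty_of_bounded (hfn n) ⟨_, hxX i⟩
        (isCompact_univ.isBounded.subset (subset_univ _))
        (isCompact_univ.isBounded.subset (subset_univ _)))
    obtain ⟨y, hy1, hy2⟩ := mem_closure_iff.1 (frontier_subset_closure hz) _ ho (hrB hzr)
    exact ⟨y, hy2, hy1⟩
  obtain ⟨n₀, hn₀⟩ := eventually_atTop.1 (eventually_all.2 hev)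
  have hDcl : ∀ i, IsClosed (e i '' closedBall (0 : ℂ) 1) := fun i => isClosed_chart_image (he i) 1
  have hmain : ∀ n, ∃ σ : Equiv.Perm (Fin 3), ∃ O P : Set S, IsOpen O ∧ IsPreconnected O ∧
      O ⊆ U (n₀ + n) \ (e (σ 0) '' closedBall 0 1 ∪ e (σ 2) '' closedBall 0 1) ∧
      (e (σ 1) '' closedBall 0 1 ∩ O).Nonempty ∧
      IsOpen P ∧ IsPreconnected P ∧ e (σ 0) 0 ∈ P ∧ e (σ 2) 0 ∈ P ∧
      P \ (e (σ 0) '' closedBall 0 1 ∪ e (σ 2) '' closedBall 0 1) ⊆ O := by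
    intro n
    choose p hpU hpB using fun i => hn₀ (n₀ + n) (Nat.le_add_right _ _) i
    have hpc : IsPathConnected (U (n₀ + n)) :=
      ((hUo _).isConnected_iff_isPathConnected).1 (hUc _)
    obtain ⟨γ, τ, hγ, hγp⟩ := hpc.exists_path_through_family' p hpU
    have hext : ∀ r, γ.extend r ∈ U (n₀ + n) := fun r => by
      have hr : γ.extend r ∈ range γ := by
        rw [← γ.extend_range]
        exact ⟨r, rfl⟩
      obtain ⟨v, hv⟩ := hr
      rw [← hv]
      exact hγ v
    have hγc : Continuous γ.extend := γ.continuous_extend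
    obtain ⟨σ, s, u, t, hs, hu, ht, hsu, hut, hr⟩ := exists_sorted
      (fun i => Icc 0 1 ∩ γ.extend ⁻¹' (e i '' closedBall 0 1))
      (fun i => isCompact_Icc.inter_right ((hDcl i).preimage hγc))
      (fun i => by
        refine ⟨τ i, (τ i).2, ?_⟩
        rw [mem_preimage, γ.extend_apply (τ i).2]
        have h := hγp i
        rw [Subtype.coe_eta, h]
        exact image_mono ball_subset_closedBall (hpB i))
      (fun i j hij => by
        rw [Set.disjoint_left]
        rintro r ⟨-, hr⟩ ⟨-, hr'⟩
        exact Set.disjoint_left.1 (hed i j hij) (image_subset_range _ _ hr)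
          (image_subset_range _ _ hr'))
    refine ⟨σ, exists_P hS (he _) (he _) (hed _ _ (σ.injective.ne (by decide))) (hUo _) hsu hut
      hγc.continuousOn (fun r _ => hext r) hs.2 ht.2 ?_ hu.2⟩
    rintro r hrI (h | h)
    · exact (hr r hrI).1 ⟨⟨hs.1.1.trans hrI.1.le, hrI.2.le.trans ht.1.2⟩, h⟩
    · exact (hr r hrI).2 ⟨⟨hs.1.1.trans hrI.1.le, hrI.2.le.trans ht.1.2⟩, h⟩
  choose σ O P h1 h2 h3 h4 h5 h6 h7 h8 h9 using hmain
  obtain ⟨τ, hτ⟩ := Finite.exists_infinite_fiber σ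
  have hτ' : (σ ⁻¹' {τ}).Infinite := Set.infinite_coe_iff.1 hτ
  set ι := hτ'.natEmbedding with hι
  have hστ : ∀ n, σ (ι n) = τ := fun n => (ι n).2
  have h01 : τ 0 ≠ τ 1 := τ.injective.ne (by decide)
  have h02 : τ 0 ≠ τ 2 := τ.injective.ne (by decide)
  have h21 : τ 2 ≠ τ 1 := τ.injective.ne (by decide)
  refine core hS (he (τ 0)) (he (τ 2)) (hed _ _ h02) (D := e (τ 1) '' closedBall 0 1)
    (Y := A (τ 1)) (U := fun n => U (n₀ + ι n)) (O := fun n => O (ι n)) (P := fun n => P (ι n))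
    (((convex_closedBall _ _).isPreconnected).image _ (he _).continuous.continuousOn)
    ?_ (hAp _) ?_ (fun n => hUo _) ?_ ?_ ?_ (fun n => h1 _) (fun n => h2 _)
    (fun n => ?_) (fun n => ?_) (fun n => h5 _) (fun n => h6 _) (fun n => ?_) (fun n => ?_)
    (fun n => ?_)
  · rintro y hy (h | h)
    · exact Set.disjoint_left.1 (hed _ _ h01) (image_subset_range _ _ h) (image_subset_range _ _ hy)
    · exact Set.disjoint_left.1 (hed _ _ h21) (image_subset_range _ _ h) (image_subset_range _ _ hy)
  · rintro y hy (h | h)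
    · exact Set.disjoint_left.1 (heA _ _ h01) (image_subset_range _ _ h) hy
    · exact Set.disjoint_left.1 (heA _ _ h21) (image_subset_range _ _ h) hy
  · intro m n hmn
    refine compl_domain_disjoint (hU _) (hU _) (hdistinct _ _ fun h => hmn ?_)
    exact ι.injective (Subtype.ext (Nat.add_left_cancel h))
  · intro n
    rw [Set.disjoint_left]
    intro y hy hyU
    exact hUX _ hyU (hAX ▸ mem_iUnion.2 ⟨_, hy⟩)
  · rintro n y ⟨hyf, hyD⟩
    have hyX := hUf _ hyf
    rw [← hAX] at hyX
    obtain ⟨j, hj⟩ := mem_iUnion.1 hyX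
    by_cases hj1 : τ 1 = j
    · rw [hj1]; exact hj
    · exact absurd hj (Set.disjoint_left.1 (heA _ _ hj1) (image_subset_range _ _ hyD))
  · have := h3 (ι n); rw [hστ] at this; exact this
  · have := h4 (ι n); rw [hστ] at this; exact this
  · have := h7 (ι n); rw [hστ] at this; exact this
  · have := h8 (ι n); rw [hστ] at this; exact this
  · have := h9 (ι n); rw [hστ] at this; exact this

/-- **Burgess's Theorem for Surfaces.** If a continuum `X` in a closed surface `S`
has a sequence of pairwise distinct complementary domains whose frontiers converge
to `X` in the Hausdorff metric, then `X` is indecomposable or 2-indecomposable. -/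
theorem burgess_theorem_for_surfaces
    {S : Type*} [MetricSpace S] [CompactSpace S] [ConnectedSpace S] [Nonempty S]
    (hS : LocallyEuclidean2 S)
    (X : Set S) (hX : IsContinuum X)
    (U : ℕ → Set S) (hU : ∀ n, IsComplementaryDomain X (U n))
    (hdistinct : ∀ m n, m ≠ n → U m ≠ U n)
    (hconv : HausdorffConvergesTo (fun n => frontier (U n)) X) :
    ¬ IsDecomposable X ∨ Is2Indecomposable X := by
  by_cases hdec : IsDecomposable X
  · refine Or.inr ⟨hdec, ?_⟩
    rintro ⟨X₁, X₂, X₃, h1, h2, h3, hun, hn1, hn2, hn3⟩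
    obtain ⟨x₁, hx1, hx1'⟩ := not_subset.1 hn1
    obtain ⟨x₂, hx2, hx2'⟩ := not_subset.1 hn2
    obtain ⟨x₃, hx3, hx3'⟩ := not_subset.1 hn3
    simp only [mem_union, not_or] at hx1' hx2' hx3'
    refine not_three hS.hasCharts hX.1.isClosed (A := ![X₁, X₂, X₃]) (x := ![x₁, x₂, x₃])
      ?_ ?_ ?_ ?_ ?_ U hU hdistinct hconv
    · intro i
      fin_cases i
      · exact h1.2.1
      · exact h2.2.1
      · exact h3.2.1
    · intro i
      fin_cases i
      · exact h1.2.2.1.isPreconnected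
      · exact h2.2.2.1.isPreconnected
      · exact h3.2.2.1.isPreconnected
    · rw [← hun]
      ext y
      simp [Fin.exists_fin_succ, or_assoc]
    · intro i
      fin_cases i
      · exact hx1
      · exact hx2
      · exact hx3
    · intro i j hij
      fin_cases i <;> fin_cases j <;> simp_all
  · exact Or.inl hdec
end

section
/- Let X be an indecomposable continuum in a closed surface S. Then there exists a sequence (Uₙ) of (not necessarily distinct) complementary domains of X such that the frontiers ∂Uₙ converge to X in the Hausdorff metric. -/
open Set Metric Filter Topology

/-- Separation of a component of a compact set from a closed set by a relatively clopen set. -/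
theorem clopen_sep {α : Type*} [TopologicalSpace α] [T2Space α] {F E : Set α} (hF : IsCompact F)
    (hE : IsClosed E) {q : α} (hq : q ∈ F) (hd : Disjoint (connectedComponentIn F q) E) :
    ∃ Z, Z ⊆ F ∧ IsClosed Z ∧ IsClosed (F \ Z) ∧ q ∈ Z ∧ Disjoint Z E := by
  have : CompactSpace F := isCompact_iff_compactSpace.1 hF
  rw [connectedComponentIn_eq_image hq, connectedComponent_eq_iInter_isClopen] at hd
  set E' : Set F := Subtype.val ⁻¹' E with hE'
  have hEc : IsCompact E' := (hE.preimage continuous_subtype_val).isCompact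
  have hem : E' ∩ ⋂ s : { s : Set F // IsClopen s ∧ (⟨q, hq⟩ : F) ∈ s }, (s : Set F) = ∅ := by
    rw [eq_empty_iff_forall_notMem]
    rintro y ⟨hy1, hy2⟩
    exact Set.disjoint_left.1 hd ⟨y, hy2, rfl⟩ hy1
  obtain ⟨t, ht⟩ := hEc.elim_finite_subfamily_closed _ (fun s => s.2.1.1) hem
  have hcl : IsClopen (⋂ s ∈ t, (s : Set F)) :=
    isClopen_biInter_finset (fun s _ => s.2.1)
  refine ⟨Subtype.val '' (⋂ s ∈ t, (s : Set F)), ?_, ?_, ?_, ?_, ?_⟩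
  · rintro _ ⟨y, -, rfl⟩; exact y.2
  · exact (hcl.1.isCompact.image continuous_subtype_val).isClosed
  · have : F \ Subtype.val '' (⋂ s ∈ t, (s : Set F)) = Subtype.val '' (⋂ s ∈ t, (s : Set F))ᶜ := by
      ext y
      constructor
      · rintro ⟨h1, h2⟩
        exact ⟨⟨y, h1⟩, fun h => h2 ⟨_, h, rfl⟩, rfl⟩
      · rintro ⟨z, h1, rfl⟩
        refine ⟨z.2, ?_⟩
        rintro ⟨w, hw, hwz⟩
        exact h1 (Subtype.ext hwz ▸ hw)
    rw [this]
    exact (hcl.compl.1.isCompact.image continuous_subtype_val).isClosed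
  · exact ⟨⟨q, hq⟩, mem_iInter₂.2 fun s _ => s.2.2, rfl⟩
  · rw [Set.disjoint_left]
    rintro _ ⟨y, hy, rfl⟩ hyE
    exact (eq_empty_iff_forall_notMem.1 ht) y ⟨hyE, hy⟩

/-- Boundary bumping. -/
theorem boundary_bump {Y : Type*} [TopologicalSpace Y] [T2Space Y] [CompactSpace Y]
    [PreconnectedSpace Y] {B : Set Y} (hB : IsOpen B) (hne : B.Nonempty) {q : Y} (hq : q ∉ B) :
    (connectedComponentIn Bᶜ q ∩ closure B).Nonempty := by
  by_contra hcon
  rw [Set.not_nonempty_iff_eq_empty, ← Set.disjoint_iff_inter_eq_empty] at hcon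
  obtain ⟨Z, hZ, hZc, hZc', hqZ, hZE⟩ := clopen_sep (hB.isClosed_compl.isCompact)
    isClosed_closure (by exact hq) hcon
  have hclop : IsClopen Z := by
    refine ⟨hZc, ?_⟩
    have : Zᶜ = (Bᶜ \ Z) ∪ closure B := by
      ext y
      simp only [mem_compl_iff, mem_union, Set.mem_sdiff]
      constructor
      · intro h
        by_cases hy : y ∈ B
        · exact Or.inr (subset_closure hy)
        · exact Or.inl ⟨hy, h⟩
      · rintro (h | h)
        · exact h.2
        · exact fun h' => Set.disjoint_left.1 hZE h' h
    rw [← isClosed_compl_iff, this]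
    exact hZc'.union isClosed_closure
  rcases isClopen_iff.1 hclop with h | h
  · simp [h] at hqZ
  · obtain ⟨b, hb⟩ := hne
    exact hZ (h ▸ mem_univ b) hb

/-- Intrinsic indecomposability. -/
def Indec (Y : Type*) [TopologicalSpace Y] : Prop :=
  ∀ A B : Set Y, IsClosed A → IsClosed B → IsPreconnected A → IsPreconnected B →
    A ∪ B = univ → A = univ ∨ B = univ

theorem union_preconn {Y : Type*} [TopologicalSpace Y] [PreconnectedSpace Y] {H u v : Set Y}
    (hH : IsPreconnected H) (hHne : H.Nonempty) (hu : IsOpen u) (hv : IsOpen v)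
    (huv : Hᶜ = u ∪ v) (hd : Disjoint u v) : IsPreconnected vᶜ := by
  have hHu : Disjoint H u := by
    rw [Set.disjoint_left]; intro x hx hxu
    exact (huv ▸ Or.inl hxu : x ∈ Hᶜ) hx
  have hHv : H ⊆ vᶜ := by
    intro x hx hxv
    exact (huv ▸ Or.inr hxv : x ∈ Hᶜ) hx
  have key : ∀ s t : Set Y, IsClosed s → IsClosed t → vᶜ ⊆ s ∪ t → (vᶜ ∩ t).Nonempty →
      H ⊆ s → (vᶜ ∩ (s ∩ t)).Nonempty := by
    intro s t hs ht hst htn hHs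
    by_contra hcon
    rw [Set.not_nonempty_iff_eq_empty, eq_empty_iff_forall_notMem] at hcon
    have h1 : vᶜ ∩ t = u ∩ sᶜ := by
      ext y
      constructor
      · rintro ⟨h1, h2⟩
        have h3 : y ∉ s := fun h => hcon y ⟨h1, h, h2⟩
        have h4 : y ∈ Hᶜ := fun h => h3 (hHs h)
        rw [huv] at h4
        exact ⟨h4.resolve_right h1, h3⟩
      · rintro ⟨h1, h2⟩
        have h3 : y ∈ vᶜ := Set.disjoint_left.1 hd h1
        exact ⟨h3, (hst h3).resolve_left h2⟩
    have hclop : IsClopen (vᶜ ∩ t) :=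
      ⟨hv.isClosed_compl.inter ht, h1 ▸ hu.inter hs.isOpen_compl⟩
    rcases isClopen_iff.1 hclop with h | h
    · simp [h] at htn
    · obtain ⟨x, hx⟩ := hHne
      have : x ∈ u ∩ sᶜ := h1 ▸ h ▸ mem_univ x
      exact this.2 (hHs hx)
  rw [isPreconnected_closed_iff]
  intro s t hs ht hst hsn htn
  by_cases hHs : H ⊆ s
  · exact key s t hs ht hst htn hHs
  by_cases hHt : H ⊆ t
  · rw [inter_comm s t]
    exact key t s ht hs (by rwa [union_comm]) hsn hHt
  rw [not_subset] at hHs hHt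
  obtain ⟨a, ha, has⟩ := hHs
  obtain ⟨b, hb, hbt⟩ := hHt
  obtain ⟨x, hx, hx'⟩ := isPreconnected_closed_iff.1 hH s t hs ht (hHv.trans hst)
    ⟨b, hb, (hst (hHv hb)).resolve_right hbt⟩ ⟨a, ha, (hst (hHv ha)).resolve_left has⟩
  exact ⟨x, hHv hx, hx'⟩

theorem Indec.isNowhereDense {Y : Type*} [TopologicalSpace Y] [PreconnectedSpace Y]
    (hY : Indec Y) {H : Set Y} (hc : IsClosed H) (hH : IsPreconnected H) (hne : H ≠ univ) :
    IsNowhereDense H := by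
  rcases H.eq_empty_or_nonempty with rfl | hHne
  · exact isNowhereDense_empty
  rw [hc.isNowhereDense_iff]
  by_cases hO : IsPreconnected Hᶜ
  · have := hY H (closure Hᶜ) hc isClosed_closure hH hO.closure (by
      rw [eq_univ_iff_forall]; intro x
      by_cases h : x ∈ H
      · exact Or.inl h
      · exact Or.inr (subset_closure h))
    rcases this with h | h
    · exact absurd h hne
    · rw [closure_compl] at h
      exact compl_univ_iff.1 h
  · exfalso
    unfold IsPreconnected at hO
    push Not at hO
    obtain ⟨u, v, hu, hv, huv, ⟨a, haO, hau⟩, ⟨b, hbO, hbv⟩, hem⟩ := hO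
    have hHo : IsOpen Hᶜ := hc.isOpen_compl
    have h1 : Hᶜ = (Hᶜ ∩ u) ∪ (Hᶜ ∩ v) := by
      rw [← inter_union_distrib_left, inter_eq_left.2 huv]
    have h2 : Disjoint (Hᶜ ∩ u) (Hᶜ ∩ v) := by
      rw [Set.disjoint_left]
      rintro x ⟨h1, h2⟩ ⟨_, h3⟩
      have : x ∈ Hᶜ ∩ (u ∩ v) := ⟨h1, h2, h3⟩
      simp [hem] at this
    have c1 := union_preconn hH hHne (hHo.inter hu) (hHo.inter hv) h1 h2
    have c2 := union_preconn hH hHne (hHo.inter hv) (hHo.inter hu) (by rwa [union_comm]) h2.symm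
    rcases hY _ _ (hHo.inter hv).isClosed_compl (hHo.inter hu).isClosed_compl c1 c2 (by
      rw [← compl_inter, inter_comm, h2.inter_eq, compl_empty]) with h | h
    · rw [compl_univ_iff] at h
      have : b ∈ Hᶜ ∩ v := ⟨hbO, hbv⟩
      simp [h] at this
    · rw [compl_univ_iff] at h
      have : a ∈ Hᶜ ∩ u := ⟨haO, hau⟩
      simp [h] at this

theorem closedComp {Y : Type*} [TopologicalSpace Y] {F : Set Y} (hF : IsClosed F) (q : Y) :
    IsClosed (connectedComponentIn F q) := by
  by_cases hq : q ∈ F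
  · refine isClosed_of_closure_subset ?_
    refine (isPreconnected_connectedComponentIn.closure).subset_connectedComponentIn
      (subset_closure (mem_connectedComponentIn hq)) ?_
    exact closure_minimal (connectedComponentIn_subset F q) hF
  · rw [connectedComponentIn_eq_empty hq]; exact isClosed_empty

theorem composants {Y : Type*} [MetricSpace Y] [CompactSpace Y] [ConnectedSpace Y] [Nontrivial Y]
    (hY : Indec Y) (x0 : Y) (r0 : ℝ) (hr0 : 0 < r0) {n : ℕ} (B : Fin n → Set Y)
    (hB : ∀ j, IsOpen (B j)) (hBne : ∀ j, (B j).Nonempty) :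
    ∃ r, 0 < r ∧ r ≤ r0 ∧ ∀ m : ℕ, ∃ C Z : Fin m → Set Y,
      (∀ k, IsPreconnected (C k) ∧ C k ⊆ (ball x0 r)ᶜ ∧ ∀ j, (C k ∩ B j).Nonempty) ∧
      (∀ k, Z k ⊆ (ball x0 (r/2))ᶜ ∧ IsClosed (Z k) ∧ IsClosed ((ball x0 (r/2))ᶜ \ Z k) ∧
        C k ⊆ Z k ∧ ∀ l, l ≠ k → Disjoint (C l) (Z k)) := by
  classical
  set A : ℕ → Set Y := fun i => {q | q ∈ (ball x0 (r0/(i+1)))ᶜ ∧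
    ∀ j, (connectedComponentIn (ball x0 (r0/(i+1)))ᶜ q ∩ B j).Nonempty} with hA
  obtain ⟨b, hbc, hbe, hb⟩ := TopologicalSpace.exists_countable_basis Y
  have hpt : ∀ q : Y, (∀ V ∈ b, q ∉ connectedComponentIn Vᶜ x0) → ∃ i, q ∈ A i := by
    intro q hq
    have hav : ∀ H : Set Y, IsClosed H → IsPreconnected H → H ≠ univ → q ∈ H → x0 ∉ H := by
      intro H hc hH hne hqH hx0
      obtain ⟨z, hz⟩ := (ne_univ_iff_exists_notMem H).1 hne
      obtain ⟨V, hVb, hzV, hV⟩ := hb.exists_subset_of_mem_open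
        (show z ∈ Hᶜ from hz) hc.isOpen_compl
      exact hq V hVb (hH.subset_connectedComponentIn hx0
        (fun x hx hxV => hV hxV hx) hqH)
    have hsing : ({q} : Set Y) ≠ univ := by
      intro h
      obtain ⟨z, hz⟩ := exists_ne q
      exact hz (h ▸ mem_univ z : z ∈ ({q} : Set Y))
    have hqx : x0 ∉ ({q} : Set Y) := hav _ isClosed_singleton isPreconnected_singleton hsing rfl
    have hH : ∀ j, ∃ H : Set Y, IsClosed H ∧ IsPreconnected H ∧ q ∈ H ∧ x0 ∉ H ∧
        (H ∩ B j).Nonempty := by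
      intro j
      obtain ⟨z, hz⟩ := hBne j
      obtain ⟨ε, hε, hεB⟩ := nhds_basis_closedBall.mem_iff.1 ((hB j).mem_nhds hz)
      obtain ⟨V, hzV, hVo, hVB⟩ : ∃ V : Set Y, z ∈ V ∧ IsOpen V ∧ closure V ⊆ B j :=
        ⟨ball z ε, mem_ball_self hε, isOpen_ball, closure_ball_subset_closedBall.trans hεB⟩
      by_cases hqV : q ∈ V
      · exact ⟨{q}, isClosed_singleton, isPreconnected_singleton, rfl, hqx,
          ⟨q, rfl, hVB (subset_closure hqV)⟩⟩
      · have hc := closedComp hVo.isClosed_compl q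
        have hqm : q ∈ connectedComponentIn Vᶜ q := mem_connectedComponentIn hqV
        obtain ⟨w, hw1, hw2⟩ := boundary_bump hVo ⟨z, hzV⟩ hqV
        refine ⟨_, hc, isPreconnected_connectedComponentIn, hqm,
          hav _ hc isPreconnected_connectedComponentIn ?_ hqm, w, hw1, hVB hw2⟩
        intro h
        exact connectedComponentIn_subset Vᶜ q (h ▸ mem_univ z) hzV
    choose H hHc hHp hHq hHx hHB using hH
    set K : Set Y := {q} ∪ ⋃ j, H j with hK
    have hKc : IsClosed K := isClosed_singleton.union (isClosed_iUnion_of_finite hHc)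
    have hKp : IsPreconnected K := by
      refine isPreconnected_of_forall q ?_
      rintro y (hy | hy)
      · exact ⟨{q}, subset_union_left, rfl, hy, isPreconnected_singleton⟩
      · obtain ⟨j, hj⟩ := mem_iUnion.1 hy
        exact ⟨H j, (subset_iUnion H j).trans subset_union_right, hHq j, hj, hHp j⟩
    have hKx : x0 ∈ Kᶜ := by
      rintro (h | h)
      · exact hqx h
      · obtain ⟨j, hj⟩ := mem_iUnion.1 h
        exact hHx j hj
    obtain ⟨ε, hε, hεK⟩ := Metric.isOpen_iff.1 hKc.isOpen_compl x0 hKx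
    obtain ⟨i, hi⟩ := exists_nat_gt (r0 / ε)
    have hir : r0 / (i + 1) ≤ ε := by
      rw [div_le_iff₀ (by positivity)]
      rw [div_lt_iff₀ hε] at hi
      nlinarith
    have hKi : K ⊆ (ball x0 (r0/(i+1)))ᶜ := by
      intro y hy hyb
      exact hεK (ball_subset_ball hir hyb) hy
    have hqK : q ∈ K := Or.inl rfl
    refine ⟨i, hKi hqK, fun j => ?_⟩
    obtain ⟨w, hw1, hw2⟩ := hHB j
    exact ⟨w, hKp.subset_connectedComponentIn hqK hKi (Or.inr (mem_iUnion.2 ⟨j, hw1⟩)), hw2⟩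
  have hex : ∃ i, ¬ IsMeagre (A i) := by
    by_contra hcon
    push Not at hcon
    have h1 : IsMeagre (⋃ i, A i) := isMeagre_iUnion hcon
    have h2 : IsMeagre (⋃ V ∈ b, connectedComponentIn Vᶜ x0) := by
      refine isMeagre_biUnion hbc fun V hV => ?_
      refine (hY.isNowhereDense (closedComp (hb.isOpen hV).isClosed_compl x0)
        isPreconnected_connectedComponentIn ?_).isMeagre
      intro h
      obtain ⟨z, hz⟩ : V.Nonempty := by
        rw [nonempty_iff_ne_empty]; rintro rfl; exact hbe hV
      exact connectedComponentIn_subset Vᶜ x0 (h ▸ mem_univ z) hz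
    refine not_isMeagre_of_isOpen (isOpen_univ (X := Y)) univ_nonempty ((h1.union h2).mono ?_)
    intro q _
    by_cases hq : ∀ V ∈ b, q ∉ connectedComponentIn Vᶜ x0
    · exact Or.inl (mem_iUnion.2 (hpt q hq))
    · push Not at hq
      obtain ⟨V, hV, hqV⟩ := hq
      exact Or.inr (mem_iUnion₂.2 ⟨V, hV, hqV⟩)
  obtain ⟨i, hi⟩ := hex
  set r := r0 / (i + 1) with hr
  have hrpos : 0 < r := by positivity
  refine ⟨r, hrpos, div_le_self hr0.le (by linarith [(Nat.cast_nonneg i : (0:ℝ) ≤ i)]), ?_⟩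
  set F : Set Y := (ball x0 (r/2))ᶜ with hF
  have hFc : IsClosed F := isOpen_ball.isClosed_compl
  have hsub : (ball x0 r)ᶜ ⊆ F := compl_subset_compl.2 (ball_subset_ball (by linarith))
  have hinf : ((connectedComponentIn F) '' A i).Infinite := by
    intro hfin
    apply hi
    have hcov : A i ⊆ ⋃₀ ((connectedComponentIn F) '' A i) := by
      intro q hq
      exact ⟨_, mem_image_of_mem _ hq, mem_connectedComponentIn (hsub hq.1)⟩
    have hnd : ∀ s ∈ (connectedComponentIn F) '' A i, IsNowhereDense s := by
      rintro _ ⟨q, hq, rfl⟩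
      refine hY.isNowhereDense (closedComp hFc q) isPreconnected_connectedComponentIn ?_
      intro h
      exact connectedComponentIn_subset F q (h ▸ mem_univ x0) (mem_ball_self (by positivity))
    refine IsMeagre.mono hcov ?_
    rw [sUnion_eq_biUnion]
    exact isMeagre_biUnion hfin.countable fun s hs => (hnd s hs).isMeagre
  intro m
  have hq : ∃ q : Fin m → Y, (∀ k, q k ∈ A i) ∧
      ∀ k l, k ≠ l → connectedComponentIn F (q k) ≠ connectedComponentIn F (q l) := by
    have h1 : ∀ k : Fin m, ∃ q ∈ A i, connectedComponentIn F q = hinf.natEmbedding _ k :=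
      fun k => (hinf.natEmbedding _ k).2
    choose q hq1 hq2 using h1
    refine ⟨q, hq1, fun k l hkl h => hkl ?_⟩
    rw [hq2, hq2] at h
    exact Fin.ext ((hinf.natEmbedding _).injective (Subtype.ext h))
  obtain ⟨q, hqA, hqd⟩ := hq
  have hqF : ∀ k, q k ∈ F := fun k => hsub (hqA k).1
  have hZ : ∀ k l, ∃ Z, Z ⊆ F ∧ IsClosed Z ∧ IsClosed (F \ Z) ∧ q k ∈ Z ∧
      (l ≠ k → q l ∉ Z) := by
    intro k l
    by_cases hkl : l = k
    · exact ⟨F, subset_rfl, hFc, by simp, hqF k, fun h => absurd hkl h⟩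
    · obtain ⟨Z, h1, h2, h3, h4, h5⟩ := clopen_sep (E := {q l}) hFc.isCompact isClosed_singleton
        (hqF k) (by
          rw [disjoint_singleton_right]
          intro h
          exact hqd k l (Ne.symm hkl) (connectedComponentIn_eq h))
      exact ⟨Z, h1, h2, h3, h4, fun _ => disjoint_singleton_right.1 h5⟩
  choose Z hZF hZc hZc' hZq hZl using hZ
  set W : Fin m → Set Y := fun k => F ∩ ⋂ l, Z k l with hW
  have hWc : ∀ k, IsClosed (W k) := fun k => hFc.inter (isClosed_iInter (hZc k))
  have hWc' : ∀ k, IsClosed (F \ W k) := by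
    intro k
    have : F \ W k = ⋃ l, (F \ Z k l) := by
      ext y; simp only [hW, Set.mem_sdiff, mem_inter_iff, mem_iInter, mem_iUnion]
      constructor
      · rintro ⟨h1, h2⟩; push Not at h2; obtain ⟨l, hl⟩ := h2 h1; exact ⟨l, h1, hl⟩
      · rintro ⟨l, h1, h2⟩; exact ⟨h1, fun h => h2 (h.2 l)⟩
    rw [this]; exact isClosed_iUnion_of_finite (hZc' k)
  -- a preconnected subset of F lies in W k or misses it
  have hdich : ∀ k (C : Set Y), IsPreconnected C → C ⊆ F → (C ∩ W k).Nonempty → C ⊆ W k := by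
    intro k C hC hCF hCW y hy
    by_contra hyW
    obtain ⟨z, _, hz1, hz2⟩ := isPreconnected_closed_iff.1 hC (W k) (F \ W k) (hWc k) (hWc' k)
      (fun z hz => by
        by_cases h : z ∈ W k
        · exact Or.inl h
        · exact Or.inr ⟨hCF hz, h⟩) hCW ⟨y, hy, hCF hy, hyW⟩
    exact hz2.2 hz1
  set C : Fin m → Set Y := fun k => connectedComponentIn (ball x0 r)ᶜ (q k) with hC
  have hCp : ∀ k, IsPreconnected (C k) := fun k => isPreconnected_connectedComponentIn
  have hCs : ∀ k, C k ⊆ (ball x0 r)ᶜ := fun k => connectedComponentIn_subset _ _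
  have hCq : ∀ k, q k ∈ C k := fun k => mem_connectedComponentIn (hqA k).1
  refine ⟨C, W, fun k => ⟨hCp k, hCs k, (hqA k).2⟩, fun k => ⟨inter_subset_left, hWc k, hWc' k,
    hdich k _ (hCp k) ((hCs k).trans hsub) ⟨q k, hCq k, hqF k, mem_iInter.2 (hZq k)⟩, ?_⟩⟩
  intro l hlk
  rw [Set.disjoint_left]
  intro y hy hyW
  have := hdich k _ (hCp l) ((hCs l).trans hsub) ⟨y, hy, hyW⟩ (hCq l)
  exact hZl k l hlk (mem_iInter.1 this.2 l)

theorem int_const {S : Type*} [TopologicalSpace S] {G : Set S} (hG : IsPreconnected G) {g : S → ℝ}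
    (hg : ContinuousOn g G) (hz : ∀ x ∈ G, (g x : AddCircle (1:ℝ)) = 0) {x y : S} (hx : x ∈ G)
    (hy : y ∈ G) : g x = g y := by
  refine hG.constant_of_mapsTo (T := (AddSubgroup.zmultiples (1:ℝ) : Set ℝ)) ?_ hg ?_ hx hy
  · exact ⟨inferInstanceAs (DiscreteTopology (AddSubgroup.zmultiples (1:ℝ)))⟩
  · intro z hz'
    have := hz z hz'
    exact (QuotientAddGroup.eq_zero_iff _).1 this

/-- Every circle-valued function on `D` has a real lift. -/
def LiftOn {S : Type*} [TopologicalSpace S] (D : Set S) : Prop :=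
  ∀ φ : S → AddCircle (1:ℝ), ContinuousOn φ D →
    ∃ θ : S → ℝ, ContinuousOn θ D ∧ ∀ x ∈ D, (θ x : AddCircle (1:ℝ)) = φ x

theorem charts {S : Type*} [TopologicalSpace S] (hS : LocallyEuclidean2 S) (x : S) (O : Set S)
    (hO : IsOpen O) (hx : x ∈ O) :
    ∃ D : Set S, IsOpen D ∧ x ∈ D ∧ D ⊆ O ∧ IsPreconnected D ∧ LiftOn D := by
  obtain ⟨U, hU, hxU, ⟨e⟩⟩ := hS x
  have hO' : IsOpen (e.symm ⁻¹' (Subtype.val ⁻¹' O)) :=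
    (hO.preimage continuous_subtype_val).preimage e.symm.continuous
  obtain ⟨ε, hε, hb⟩ := Metric.isOpen_iff.1 hO' (e ⟨x, hxU⟩) (by simpa using hx)
  set b : Set (EuclideanSpace ℝ (Fin 2)) := ball (e ⟨x, hxU⟩) ε with hbdef
  set ψ : EuclideanSpace ℝ (Fin 2) → S := fun z => (e.symm z : S) with hψ
  have hψc : Continuous ψ := continuous_subtype_val.comp e.symm.continuous
  have hψo : IsOpenMap ψ := hU.isOpenMap_subtype_val.comp e.symm.isOpenMap
  have hconv : Convex ℝ b := convex_ball _ _
  refine ⟨ψ '' b, hψo _ isOpen_ball, ⟨e ⟨x, hxU⟩, mem_ball_self hε, by simp [hψ]⟩, ?_,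
    hconv.isPreconnected.image _ hψc.continuousOn, ?_⟩
  · rintro _ ⟨z, hz, rfl⟩; exact hb hz
  intro φ hφ
  have hbne : b.Nonempty := ⟨_, mem_ball_self hε⟩
  have : ContractibleSpace b := hconv.contractibleSpace hbne
  have : LocallyPathConnectedSpace b := isOpen_ball.locallyPathConnectedSpace
  let f : C(b, AddCircle (1:ℝ)) := ⟨fun z => φ (ψ z),
    hφ.comp_continuous (hψc.comp continuous_subtype_val) (fun z => ⟨z, z.2, rfl⟩)⟩
  obtain ⟨e₀, he₀⟩ := QuotientAddGroup.mk_surjective (f ⟨_, mem_ball_self hε⟩)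
  obtain ⟨F, ⟨-, hF⟩, -⟩ := (AddCircle.isCoveringMap_coe (1:ℝ)).existsUnique_continuousMap_lifts
    f ⟨_, mem_ball_self hε⟩ e₀ he₀
  classical
  have hDU : ∀ y ∈ ψ '' b, ∃ h : y ∈ U, e ⟨y, h⟩ ∈ b := by
    rintro _ ⟨z, hz, rfl⟩
    exact ⟨(e.symm z).2, by simpa [hψ] using hz⟩
  refine ⟨fun y => if h : ∃ h : y ∈ U, e ⟨y, h⟩ ∈ b then F ⟨e ⟨y, h.1⟩, h.2⟩ else 0, ?_, ?_⟩
  · rw [continuousOn_iff_continuous_domRestrict]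
    have : Continuous fun y : ψ '' b => F ⟨e ⟨y, (hDU y y.2).1⟩, (hDU y y.2).2⟩ := by fun_prop
    convert this using 2 with y
    rw [Set.domRestrict_apply, dif_pos (hDU y y.2)]
  · intro y hy
    have h := hDU y hy
    beta_reduce
    rw [dif_pos h]
    have := congrFun hF ⟨e ⟨y, h.1⟩, h.2⟩
    simpa [f, hψ] using this

theorem locConn {S : Type*} [TopologicalSpace S] (hS : LocallyEuclidean2 S) :
    LocallyConnectedSpace S := by
  rw [locallyConnectedSpace_iff_connected_subsets]
  intro x U hU
  obtain ⟨O, hOU, hO, hx⟩ := mem_nhds_iff.1 hU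
  obtain ⟨D, hD, hxD, hDO, hp, -⟩ := charts hS x O hO hx
  exact ⟨D, hD.mem_nhds hxD, hp, hDO.trans hOU⟩

theorem finite_rank {S : Type*} [TopologicalSpace S] [T2Space S] [LocallyConnectedSpace S]
    (hc : ∀ (x : S) (O : Set S), IsOpen O → x ∈ O → ∃ D : Set S, IsOpen D ∧ x ∈ D ∧ D ⊆ O ∧ LiftOn D)
    {M M' : Set S} (hM : IsCompact M) (hM' : IsOpen M') (hMM : M ⊆ M') :
    ∃ (T : Finset (S × S × S)) (v : (S → AddCircle (1:ℝ)) → S × S × S → ℤ),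
      ∀ (m : ℕ) (φ : Fin m → S → AddCircle (1:ℝ)), (∀ k, ContinuousOn (φ k) M') →
      ∀ a : Fin m → ℤ, (∀ t ∈ T, ∑ k, a k * v (φ k) t = 0) →
      ∃ h : S → ℝ, ContinuousOn h M ∧
        ∀ x ∈ M, (h x : AddCircle (1:ℝ)) = ∑ k, a k • φ k x := by
  classical
  have hD : ∀ x : S, ∃ D : Set S, x ∈ M → (IsOpen D ∧ x ∈ D ∧ D ⊆ M' ∧ LiftOn D) := by
    intro x
    by_cases hx : x ∈ M
    · obtain ⟨D, h⟩ := hc x M' hM' (hMM hx)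
      exact ⟨D, fun _ => h⟩
    · exact ⟨∅, fun h => absurd h hx⟩
  choose D hD using hD
  obtain ⟨t, htM, htc⟩ := hM.elim_nhds_subcover D (fun x hx => (hD x hx).1.mem_nhds (hD x hx).2.1)
  obtain ⟨K, hK, hKD, hMK⟩ := hM.finite_compact_cover t D (fun i hi => (hD i (htM i hi)).1) htc
  have hP : ∀ i i', ∃ P : Finset S, i ∈ t → i' ∈ t → (∀ p ∈ P, p ∈ D i ∩ D i') ∧
      ∀ x ∈ K i ∩ K i', ∃ p ∈ P, x ∈ connectedComponentIn (D i ∩ D i') p := by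
    intro i i'
    by_cases hi : i ∈ t ∧ i' ∈ t
    · have hop : IsOpen (D i ∩ D i') := (hD i (htM i hi.1)).1.inter (hD i' (htM i' hi.2)).1
      have hsub : K i ∩ K i' ⊆ D i ∩ D i' := inter_subset_inter (hKD i) (hKD i')
      obtain ⟨P, hP1, hP2⟩ := ((hK i).inter_right (hK i').isClosed).elim_nhds_subcover
        (fun p => connectedComponentIn (D i ∩ D i') p)
        (fun p hp => connectedComponentIn_mem_nhds (hop.mem_nhds (hsub hp)))
      refine ⟨P, fun _ _ => ⟨fun p hp => hsub (hP1 p hp), fun x hx => ?_⟩⟩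
      simpa using hP2 hx
    · exact ⟨∅, fun h h' => absurd ⟨h, h'⟩ hi⟩
  choose P hP using hP
  have hθ : ∀ (φ : S → AddCircle (1:ℝ)) (i : S), ∃ θ : S → ℝ, ContinuousOn φ M' → i ∈ t →
      ContinuousOn θ (D i) ∧ ∀ x ∈ D i, (θ x : AddCircle (1:ℝ)) = φ x := by
    intro φ i
    by_cases h : ContinuousOn φ M' ∧ i ∈ t
    · obtain ⟨θ, h1⟩ := (hD i (htM i h.2)).2.2.2 φ (h.1.mono (hD i (htM i h.2)).2.2.1)
      exact ⟨θ, fun _ _ => h1⟩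
    · exact ⟨0, fun h1 h2 => absurd ⟨h1, h2⟩ h⟩
  choose θ hθ using hθ
  refine ⟨t.biUnion fun i => t.biUnion fun i' => (P i i').image fun p => (i, i', p),
    fun φ z => round (θ φ z.1 z.2.2 - θ φ z.2.1 z.2.2), ?_⟩
  intro m φ hφ a ha
  -- the differences of the local lifts
  have hdiff : ∀ i ∈ t, ∀ i' ∈ t, ∀ x ∈ K i ∩ K i',
      ∑ k, (a k : ℝ) * θ (φ k) i x = ∑ k, (a k : ℝ) * θ (φ k) i' x := by
    intro i hi i' hi' x hx
    obtain ⟨hP1, hP2⟩ := hP i i' hi hi'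
    obtain ⟨p, hp, hxp⟩ := hP2 x hx
    have hG := connectedComponentIn_subset (D i ∩ D i') p
    have hpG := mem_connectedComponentIn (hP1 p hp)
    have key : ∀ k, θ (φ k) i x - θ (φ k) i' x
        = (round (θ (φ k) i p - θ (φ k) i' p) : ℤ) := by
      intro k
      obtain ⟨c1, l1⟩ := hθ (φ k) i (hφ k) hi
      obtain ⟨c2, l2⟩ := hθ (φ k) i' (hφ k) hi'
      have hz : ∀ y ∈ connectedComponentIn (D i ∩ D i') p,
          ((θ (φ k) i y - θ (φ k) i' y : ℝ) : AddCircle (1:ℝ)) = 0 := by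
        intro y hy
        rw [AddCircle.coe_sub, l1 y (hG hy).1, l2 y (hG hy).2, sub_self]
      have h1 := int_const isPreconnected_connectedComponentIn
        (g := fun y => θ (φ k) i y - θ (φ k) i' y)
        ((c1.mono (hG.trans inter_subset_left)).sub (c2.mono (hG.trans inter_subset_right)))
        hz hxp hpG
      obtain ⟨n, hn⟩ := (AddCircle.coe_eq_zero_iff (1:ℝ)).1 (hz p hpG)
      simp only [zsmul_eq_mul, mul_one] at hn
      rw [h1, ← hn, round_intCast]
    have h0 := ha (i, i', p) (by
      simp only [Finset.mem_biUnion, Finset.mem_image]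
      exact ⟨i, hi, i', hi', p, hp, rfl⟩)
    rw [← sub_eq_zero, ← Finset.sum_sub_distrib]
    have h1 : ∀ k, (a k : ℝ) * θ (φ k) i x - a k * θ (φ k) i' x
        = ((a k * round (θ (φ k) i p - θ (φ k) i' p) : ℤ) : ℝ) := by
      intro k
      rw [← mul_sub, key k]; push_cast; rfl
    simp_rw [h1]
    rw [← Int.cast_sum]
    exact_mod_cast h0
  have hch : ∀ x : S, ∃ i : S, x ∈ M → i ∈ t ∧ x ∈ K i := by
    intro x
    by_cases hx : x ∈ M
    · rw [hMK] at hx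
      obtain ⟨i, hi, hxi⟩ := mem_iUnion₂.1 hx
      exact ⟨i, fun _ => ⟨hi, hxi⟩⟩
    · exact ⟨x, fun h => absurd h hx⟩
  choose ι hι using hch
  have hKM : ∀ i ∈ t, K i ⊆ M := fun i hi => by
    rw [hMK]; exact subset_biUnion_of_mem (u := K) hi
  refine ⟨fun x => ∑ k, (a k : ℝ) * θ (φ k) (ι x) x, ?_, ?_⟩
  · have hMK' : M = ⋃ i : t, K i := by
      rw [hMK]; ext y; simp
    rw [hMK']
    refine (locallyFinite_of_finite _).continuousOn_iUnion (fun i => (hK i).isClosed) ?_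
    rintro ⟨i, hi⟩
    refine ContinuousOn.congr (f := fun x => ∑ k, (a k : ℝ) * θ (φ k) i x) ?_ ?_
    · refine continuousOn_finsetSum _ fun k _ => continuousOn_const.mul ?_
      exact (hθ (φ k) i (hφ k) hi).1.mono (hKD i)
    · intro x hx
      have := hι x (hKM i hi hx)
      exact hdiff _ this.1 i hi x ⟨this.2, hx⟩
  · intro x hx
    have hx' := hι x hx
    have : ∀ k, ((θ (φ k) (ι x) x : ℝ) : AddCircle (1:ℝ)) = φ k x := fun k =>
      (hθ (φ k) (ι x) (hφ k) hx'.1).2 x (hKD _ hx'.2)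
    simp_rw [← this, ← AddCircle.coe_zsmul, zsmul_eq_mul]
    exact map_sum (QuotientAddGroup.mk' (AddSubgroup.zmultiples (1:ℝ))) _ _

theorem frontier_domain_subset {S : Type*} [TopologicalSpace S] [LocallyConnectedSpace S]
    {X U : Set S} (hX : IsClosed X) (hU : IsComplementaryDomain X U) : frontier U ⊆ X := by
  obtain ⟨x, hx, rfl⟩ := hU
  intro y hy
  by_contra hyX
  have hop : IsOpen (connectedComponentIn Xᶜ x) := hX.isOpen_compl.connectedComponentIn
  have hopy : connectedComponentIn Xᶜ y ∈ 𝓝 y :=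
    connectedComponentIn_mem_nhds (hX.isOpen_compl.mem_nhds hyX)
  rw [frontier, hop.interior_eq] at hy
  obtain ⟨z, hz1, hz2⟩ := mem_closure_iff_nhds.1 hy.1 _ hopy
  apply hy.2
  rw [connectedComponentIn_eq hz2, ← connectedComponentIn_eq hz1]
  exact mem_connectedComponentIn hyX

theorem frontier_meets {S : Type*} [TopologicalSpace S] {U B : Set S} (hU : IsOpen U)
    (hB : IsPreconnected B) (h1 : (U ∩ B).Nonempty) (h2 : ∃ y ∈ B, y ∉ U) :
    (B ∩ frontier U).Nonempty := by
  by_contra hcon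
  rw [Set.not_nonempty_iff_eq_empty, eq_empty_iff_forall_notMem] at hcon
  have hfr : ∀ y ∈ B, y ∉ U → y ∈ (closure U)ᶜ := by
    intro y hy hyU hyc
    exact hcon y ⟨hy, by rw [frontier, hU.interior_eq]; exact ⟨hyc, hyU⟩⟩
  obtain ⟨y, hy, hyU⟩ := h2
  obtain ⟨u, huU, huB⟩ := h1
  obtain ⟨z, -, hz1, hz2⟩ := hB U (closure U)ᶜ hU isClosed_closure.isOpen_compl
    (fun z hz => by
      by_cases h : z ∈ U
      · exact Or.inl h
      · exact Or.inr (hfr z hz h)) ⟨u, huB, huU⟩ ⟨y, hy, hfr y hy hyU⟩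
  exact hz2 (subset_closure hz1)

theorem indec_of_not_decomposable {S : Type*} [TopologicalSpace S] {X : Set S}
    (hXc : IsClosed X) (hind : ¬ IsDecomposable X) : Indec X := by
  intro A B hA hB hAp hBp hAB
  by_contra hcon
  push Not at hcon
  have hAn : A.Nonempty := by
    rw [nonempty_iff_ne_empty]; rintro rfl; rw [empty_union] at hAB; exact hcon.2 hAB
  have hBn : B.Nonempty := by
    rw [nonempty_iff_ne_empty]; rintro rfl; rw [union_empty] at hAB; exact hcon.1 hAB
  have key : ∀ A : Set X, IsClosed A → IsPreconnected A → A.Nonempty → A ≠ univ →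
      IsProperSubcontinuum X (Subtype.val '' A) := by
    intro A hA hAp hAn hAu
    refine ⟨hAn.image _, hXc.isClosedEmbedding_subtypeVal.isClosedMap _ hA,
      ⟨hAn.image _, hAp.image _ continuous_subtype_val.continuousOn⟩, ?_, ?_⟩
    · rintro _ ⟨y, -, rfl⟩; exact y.2
    · intro h
      apply hAu
      rw [eq_univ_iff_forall]
      intro y
      obtain ⟨z, hz, hzy⟩ : (y : S) ∈ Subtype.val '' A := h.ge y.2
      exact Subtype.ext hzy ▸ hz
  refine hind ⟨_, _, key A hA hAp hAn hcon.1, key B hB hBp hBn hcon.2, ?_⟩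
  rw [← image_union, hAB, image_univ, Subtype.range_coe]

theorem exists_domain_meeting {S : Type*} [MetricSpace S] [CompactSpace S]
    (hS : LocallyEuclidean2 S) (X : Set S) (hX : IsContinuum X) (hind : ¬ IsDecomposable X)
    (hnt : X.Nontrivial) {n : ℕ} (hn : 0 < n) (B : Fin n → Set S) (hBo : ∀ j, IsOpen (B j))
    (hBp : ∀ j, IsPreconnected (B j)) (hBX : ∀ j, (X ∩ B j).Nonempty) (x0 : S) (hx0 : x0 ∈ X)
    (r0 : ℝ) (hr0 : 0 < r0) (hBr : ∀ j, Disjoint (B j) (ball x0 r0)) :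
    ∃ U, IsComplementaryDomain X U ∧ ∀ j, (U ∩ B j).Nonempty := by
  classical
  have hlc : LocallyConnectedSpace S := locConn hS
  have hXc : IsClosed X := hX.1.isClosed
  by_contra hcon
  push Not at hcon
  -- assign to each complementary domain a set `B j` it misses
  have hg : ∀ U : Set S, ∃ j : Fin n, IsComplementaryDomain X U → U ∩ B j = ∅ := by
    intro U
    by_cases hU : IsComplementaryDomain X U
    · obtain ⟨j, hj⟩ := hcon U hU
      exact ⟨j, fun _ => hj⟩
    · exact ⟨⟨0, hn⟩, fun h => absurd h hU⟩
  choose g hg using hg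
  set J : S → Fin n := fun y => g (connectedComponentIn Xᶜ y) with hJ
  have hJB : ∀ y ∉ X, y ∉ B (J y) := by
    intro y hy hyB
    have := hg _ ⟨y, hy, rfl⟩
    exact (eq_empty_iff_forall_notMem.1 this) y ⟨mem_connectedComponentIn hy, hyB⟩
  have : CompactSpace X := isCompact_iff_compactSpace.1 hX.1
  have : ConnectedSpace X := isConnected_iff_connectedSpace.1 hX.2
  have : Nontrivial X := hnt.coe_sort
  obtain ⟨r, hr, hrr0, hcomp⟩ := composants (indec_of_not_decomposable hXc hind) ⟨x0, hx0⟩ r0 hr0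
    (fun j => Subtype.val ⁻¹' B j) (fun j => (hBo j).preimage continuous_subtype_val)
    (fun j => by obtain ⟨y, hy1, hy2⟩ := hBX j; exact ⟨⟨y, hy1⟩, hy2⟩)
  set M : Set S := (ball x0 r)ᶜ with hM
  set M' : Set S := (closedBall x0 (r/2))ᶜ with hM'
  have hMM : M ⊆ M' := by
    apply compl_subset_compl.2
    exact closedBall_subset_ball (by linarith)
  obtain ⟨T, v, hv⟩ := finite_rank
    (fun x O hO hx => by
      obtain ⟨D, h1, h2, h3, -, h4⟩ := charts hS x O hO hx
      exact ⟨D, h1, h2, h3, h4⟩)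
    (isOpen_ball.isClosed_compl.isCompact : IsCompact M)
    (isClosed_closedBall.isOpen_compl : IsOpen M') hMM
  set m := Fintype.card (T × Fin n) + 1 with hm
  obtain ⟨C, Z, hC, hZ⟩ := hcomp (m + 1)
  -- Urysohn functions
  have hf : ∀ k : Fin (m+1), ∃ f : S → ℝ, Continuous f ∧
      (∀ y : X, y ∈ Z k → f y = 1) ∧
      (∀ y : X, y ∉ ball (⟨x0, hx0⟩ : X) (r/2) → y ∉ Z k → f y = 0) := by
    intro k
    obtain ⟨-, h1, h2, -, -⟩ := hZ k
    have hcm := hXc.isClosedEmbedding_subtypeVal.isClosedMap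
    obtain ⟨f, hf0, hf1, -⟩ := exists_continuous_zero_one_of_isClosed (hcm _ h2) (hcm _ h1) (by
      rw [Set.disjoint_left]
      rintro _ ⟨y, hy, rfl⟩ ⟨z, hz, hzy⟩
      exact hy.2 (Subtype.ext hzy ▸ hz))
    exact ⟨f, f.continuous, fun y hy => hf1 ⟨y, hy, rfl⟩, fun y hy hyZ => hf0 ⟨y, ⟨hy, hyZ⟩, rfl⟩⟩
  choose f hfc hf1 hf0 using hf
  have hfX : ∀ k, ∀ y ∈ X, y ∈ M' → ((f k y : ℝ) : AddCircle (1:ℝ)) = 0 := by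
    intro k y hyX hyM
    by_cases h : (⟨y, hyX⟩ : X) ∈ Z k
    · have := hf1 k ⟨y, hyX⟩ h
      simp only at this
      rw [this]; exact AddCircle.coe_period 1
    · have := hf0 k ⟨y, hyX⟩ (fun h' => hyM (ball_subset_closedBall h')) h
      simp only at this
      rw [this]; exact AddCircle.coe_zero (p := (1:ℝ))
  set φ : Fin m → Fin n → S → AddCircle (1:ℝ) := fun k j y =>
    if y ∉ X ∧ J y = j then ((f k.succ y : ℝ) : AddCircle (1:ℝ)) else 0 with hφ
  have hfcc : ∀ k, Continuous fun y => ((f k y : ℝ) : AddCircle (1:ℝ)) := fun k =>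
    (AddCircle.continuous_mk' 1).comp (hfc k)
  have hφc : ∀ k j, ContinuousOn (φ k j) M' := by
    intro k j y hyM
    refine ContinuousAt.continuousWithinAt ?_
    by_cases hyX : y ∈ X
    · have h0 : φ k j y = 0 := by simp [hφ, hyX]
      rw [ContinuousAt, h0]
      have h1 : Tendsto (fun y => ((f k.succ y : ℝ) : AddCircle (1:ℝ))) (𝓝 y) (𝓝 0) := by
        have := (hfcc k.succ).tendsto y
        rwa [hfX _ y hyX hyM] at this
      exact h1.if' tendsto_const_nhds
    · have hnb : connectedComponentIn Xᶜ y ∈ 𝓝 y :=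
        connectedComponentIn_mem_nhds (hXc.isOpen_compl.mem_nhds hyX)
      have hJc : ∀ z ∈ connectedComponentIn Xᶜ y, z ∉ X ∧ J z = J y := by
        intro z hz
        refine ⟨connectedComponentIn_subset _ _ hz, ?_⟩
        simp only [hJ]
        rw [connectedComponentIn_eq hz]
      by_cases hj : J y = j
      · refine ((hfcc k.succ).continuousAt (x := y)).congr ?_
        filter_upwards [hnb] with z hz
        obtain ⟨h1, h2⟩ := hJc z hz
        simp [hφ, h1, h2, hj]
      · refine (continuousAt_const (y := (0 : AddCircle (1:ℝ)))).congr ?_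
        filter_upwards [hnb] with z hz
        obtain ⟨h1, h2⟩ := hJc z hz
        simp [hφ, h1, h2, hj]
  have hφsum : ∀ k, ∀ y ∈ M', ∑ j, φ k j y = ((f k.succ y : ℝ) : AddCircle (1:ℝ)) := by
    intro k y hy
    by_cases hyX : y ∈ X
    · rw [hfX _ y hyX hy]
      exact Finset.sum_eq_zero fun j _ => by simp [hφ, hyX]
    · simp [hφ, hyX]
  -- an integer relation
  obtain ⟨a, ha, k0, hk0⟩ : ∃ a : Fin m → ℤ, (∀ j, ∀ t ∈ T, ∑ k, a k * v (φ k j) t = 0) ∧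
      ∃ k, a k ≠ 0 := by
    have hli : ¬ LinearIndependent ℤ (fun (k : Fin m) (z : T × Fin n) => v (φ k z.2) z.1) := by
      intro h
      have := h.fintype_card_le_finrank
      rw [Module.finrank_fintype_fun_eq_card, Fintype.card_fin] at this
      omega
    obtain ⟨a, ha, k, hk⟩ := Fintype.not_linearIndependent_iff.1 hli
    refine ⟨a, fun j t ht => ?_, k, hk⟩
    have := congrFun ha (⟨t, ht⟩, j)
    simpa [Finset.sum_apply] using this
  have hh := fun j => hv m (fun k => φ k j) (fun k => hφc k j) a (ha j)
  choose h hhc hhl using hh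
  have hBM : ∀ j, B j ⊆ M := by
    intro j y hy hyb
    exact Set.disjoint_left.1 (hBr j) hy (ball_subset_ball hrr0 hyb)
  -- the connected sets in `S`
  set C' : Fin (m+1) → Set S := fun l => Subtype.val '' C l with hC'
  have hC'M : ∀ l, C' l ⊆ M := by
    rintro l _ ⟨y, hy, rfl⟩ hyb
    exact (hC l).2.1 hy hyb
  have hC'p : ∀ l, IsPreconnected (C' l) := fun l =>
    (hC l).1.image _ continuous_subtype_val.continuousOn
  have hbex : ∀ l j, ∃ b, b ∈ C' l ∧ b ∈ B j := by
    intro l j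
    obtain ⟨y, hy1, hy2⟩ := (hC l).2.2 j
    exact ⟨y, ⟨y, hy1, rfl⟩, hy2⟩
  choose b hbC hbB using hbex
  have hconstB : ∀ j, ∀ x ∈ B j, ∀ y ∈ B j, h j x = h j y := by
    intro j x hx y hy
    refine int_const (hBp j) ((hhc j).mono (hBM j)) ?_ hx hy
    intro z hz
    rw [hhl j z (hBM j hz)]
    refine Finset.sum_eq_zero fun k _ => ?_
    have : ¬ (z ∉ X ∧ J z = j) := by
      rintro ⟨h1, rfl⟩
      exact hJB z h1 hz
    simp [hφ, this]
  have hconstC : ∀ j l, ∀ x ∈ C' l, ∀ y ∈ C' l, h j x = h j y := by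
    intro j l x hx y hy
    refine int_const (hC'p l) ((hhc j).mono (hC'M l)) ?_ hx hy
    rintro z hz
    rw [hhl j z (hC'M l hz)]
    refine Finset.sum_eq_zero fun k _ => ?_
    obtain ⟨w, -, rfl⟩ := hz
    simp [hφ]
  have hconst : ∀ j l l', ∀ x ∈ C' l, ∀ y ∈ C' l', h j x = h j y := by
    intro j l l' x hx y hy
    rw [hconstC j l x hx (b l j) (hbC l j), hconstB j _ (hbB l j) _ (hbB l' j),
      hconstC j l' _ (hbC l' j) y hy]
  set j0 : Fin n := ⟨0, hn⟩
  have htot : ∀ x ∈ B j0, ∀ y ∈ B j0,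
      ∑ j, h j x - ∑ k, (a k : ℝ) * f k.succ x = ∑ j, h j y - ∑ k, (a k : ℝ) * f k.succ y := by
    intro x hx y hy
    refine int_const (hBp j0) (g := fun x => ∑ j, h j x - ∑ k, (a k : ℝ) * f k.succ x) ?_ ?_ hx hy
    · refine ContinuousOn.sub ?_ ?_
      · exact continuousOn_finsetSum _ fun j _ => (hhc j).mono (hBM j0)
      · exact continuousOn_finsetSum _ fun k _ => continuousOn_const.mul (hfc _).continuousOn
    · intro z hz
      have hzM := hBM j0 hz
      have e1 : ((∑ j, h j z : ℝ) : AddCircle (1:ℝ)) = ∑ j, ((h j z : ℝ) : AddCircle (1:ℝ)) :=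
        map_sum (QuotientAddGroup.mk' (AddSubgroup.zmultiples (1:ℝ))) _ _
      have e2 : ((∑ k, (a k : ℝ) * f k.succ z : ℝ) : AddCircle (1:ℝ))
          = ∑ k, (((a k : ℝ) * f k.succ z : ℝ) : AddCircle (1:ℝ)) :=
        map_sum (QuotientAddGroup.mk' (AddSubgroup.zmultiples (1:ℝ))) _ _
      rw [AddCircle.coe_sub, e1, e2, sub_eq_zero]
      have e3 : ∀ j, ((h j z : ℝ) : AddCircle (1:ℝ)) = ∑ k, a k • φ k j z := fun j => hhl j z hzM
      simp_rw [e3]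
      rw [Finset.sum_comm]
      refine Finset.sum_congr rfl fun k _ => ?_
      rw [← Finset.smul_sum, hφsum k z (hMM hzM), ← AddCircle.coe_zsmul, zsmul_eq_mul]
  -- evaluate
  have hfC : ∀ l k, ∀ y ∈ C' l, f k y = if l = k then 1 else 0 := by
    rintro l k _ ⟨y, hy, rfl⟩
    by_cases hlk : l = k
    · subst hlk
      rw [if_pos rfl]
      exact hf1 _ y ((hZ l).2.2.2.1 hy)
    · rw [if_neg hlk]
      refine hf0 k y ?_ (Set.disjoint_left.1 ((hZ k).2.2.2.2 l hlk) hy)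
      intro hyb
      exact (hC l).2.1 hy (ball_subset_ball (by linarith) hyb)
  have hfin := htot _ (hbB 0 j0) _ (hbB k0.succ j0)
  have hs : ∑ j, h j (b 0 j0) = ∑ j, h j (b k0.succ j0) :=
    Finset.sum_congr rfl fun j _ => hconst j _ _ _ (hbC 0 j0) _ (hbC k0.succ j0)
  have hz0 : ∑ k, (a k : ℝ) * f k.succ (b 0 j0) = 0 := by
    refine Finset.sum_eq_zero fun k _ => ?_
    rw [hfC 0 k.succ _ (hbC 0 j0), if_neg (Fin.succ_ne_zero k).symm, mul_zero]
  have hz1 : ∑ k, (a k : ℝ) * f k.succ (b k0.succ j0) = a k0 := by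
    rw [Finset.sum_eq_single k0]
    · rw [hfC k0.succ k0.succ _ (hbC _ j0), if_pos rfl, mul_one]
    · intro k _ hk
      rw [hfC k0.succ k.succ _ (hbC _ j0), if_neg (fun h => hk (Fin.succ_injective _ h).symm),
        mul_zero]
    · simp
  rw [hs, hz0, hz1] at hfin
  apply hk0
  have : (a k0 : ℝ) = 0 := by linarith
  exact_mod_cast this

theorem exists_domain_close {S : Type*} [MetricSpace S] [CompactSpace S] [ConnectedSpace S]
    (hS : LocallyEuclidean2 S) (X : Set S) (hX : IsContinuum X) (hind : ¬ IsDecomposable X)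
    (ε : ℝ) (hε : 0 < ε) :
    ∃ U, IsComplementaryDomain X U ∧ ∀ x ∈ X, ∃ y ∈ frontier U, dist x y ≤ ε := by
  classical
  have hlc : LocallyConnectedSpace S := locConn hS
  have hXc : IsClosed X := hX.1.isClosed
  rcases X.subsingleton_or_nontrivial with hss | hnt
  · obtain ⟨x, hx⟩ := hX.2.1
    have hns : ∃ y, y ≠ x := by
      by_contra hcon
      push Not at hcon
      obtain ⟨V, -, -, ⟨e⟩⟩ := hS x
      obtain ⟨p, q, hpq⟩ := exists_pair_ne (EuclideanSpace ℝ (Fin 2))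
      apply hpq
      apply e.symm.injective
      apply Subtype.ext
      rw [hcon (e.symm p), hcon (e.symm q)]
    obtain ⟨y, hy⟩ := hns
    have hyX : y ∉ X := fun h => hy (hss h hx)
    have hU : IsComplementaryDomain X (connectedComponentIn Xᶜ y) := ⟨y, hyX, rfl⟩
    refine ⟨_, hU, fun z hz => ?_⟩
    have hne : (frontier (connectedComponentIn Xᶜ y)).Nonempty := by
      rw [nonempty_frontier_iff]
      refine ⟨⟨y, mem_connectedComponentIn hyX⟩, fun h => ?_⟩
      exact connectedComponentIn_subset Xᶜ y (h ▸ mem_univ x) hx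
    obtain ⟨w, hw⟩ := hne
    refine ⟨w, hw, ?_⟩
    rw [hss hz (frontier_domain_subset hXc hU hw), dist_self]
    exact hε.le
  · obtain ⟨t, htX, htf, htc⟩ := finite_cover_balls_of_compact hX.1 (half_pos hε)
    obtain ⟨x0, hx0, hx0t⟩ := (hX.2.isPreconnected.infinite_of_nontrivial hnt).exists_notMem_finite
      htf
    obtain ⟨r, hr, hrt⟩ := Metric.isOpen_iff.1 htf.isClosed.isOpen_compl x0 hx0t
    have : Fintype t := htf.fintype
    set e := (Fintype.equivFin t).symm with he
    have hn : 0 < Fintype.card t := by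
      rw [Fintype.card_pos_iff]
      obtain ⟨y, hy, -⟩ := mem_iUnion₂.1 (htc hx0)
      exact ⟨⟨y, hy⟩⟩
    have hch : ∀ j, ∃ D : Set S, IsOpen D ∧ (e j : S) ∈ D ∧
        D ⊆ ball (e j : S) (min (ε/2) (r/2)) ∧ IsPreconnected D ∧ LiftOn D := fun j =>
      charts hS (e j) _ isOpen_ball (mem_ball_self (lt_min (half_pos hε) (half_pos hr)))
    choose B hBo hBm hBs hBp _ using hch
    obtain ⟨U, hU, hUB⟩ := exists_domain_meeting hS X hX hind hnt hn B hBo hBp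
      (fun j => ⟨e j, htX (e j).2, hBm j⟩) x0 hx0 (r/2) (half_pos hr) (by
        intro j
        rw [Set.disjoint_left]
        intro y hy hyb
        have h1 : dist y (e j) < r / 2 := lt_of_lt_of_le (hBs j hy) (min_le_right _ _)
        have h2 : dist y x0 < r / 2 := hyb
        have h3 : ¬ dist (e j : S) x0 < r := fun h => hrt h (e j).2
        have h4 := dist_triangle_left (e j : S) x0 y
        linarith)
    refine ⟨U, hU, fun x hx => ?_⟩
    obtain ⟨y, hy, hxy⟩ := mem_iUnion₂.1 (htc hx)
    set j := e.symm ⟨y, hy⟩ with hj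
    have hey : (e j : S) = y := by simp [hj]
    obtain ⟨z, hzB, hzU⟩ := frontier_meets (by
        obtain ⟨w, hw, rfl⟩ := hU
        exact hXc.isOpen_compl.connectedComponentIn) (hBp j) (hUB j) ⟨e j, hBm j, by
        obtain ⟨w, hw, rfl⟩ := hU
        exact fun h => connectedComponentIn_subset _ _ h (htX (e j).2)⟩
    refine ⟨z, hzU, ?_⟩
    have h1 : dist z (e j) < ε / 2 := lt_of_lt_of_le (hBs j hzB) (min_le_left _ _)
    rw [hey] at h1
    have h2 : dist x y < ε / 2 := hxy
    have h3 := dist_triangle_right x z y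
    linarith

/-- If `X` is an indecomposable continuum in a closed surface `S`, then there is a
sequence of (not necessarily distinct) complementary domains of `X` whose frontiers
converge to `X` in the Hausdorff metric. -/
theorem exists_complementary_domains_frontier_tendsto
    {S : Type*} [MetricSpace S] [CompactSpace S] [ConnectedSpace S] [Nonempty S]
    (hS : LocallyEuclidean2 S)
    (X : Set S) (hX : IsContinuum X) (hind : ¬ IsDecomposable X) :
    ∃ U : ℕ → Set S, (∀ n, IsComplementaryDomain X (U n)) ∧
      HausdorffConvergesTo (fun n => frontier (U n)) X := by
  have hlc : LocallyConnectedSpace S := locConn hS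
  have hex := fun n : ℕ => exists_domain_close hS X hX hind (1 / ((n : ℝ) + 1)) (by positivity)
  choose U hU hUX using hex
  refine ⟨U, hU, ?_⟩
  unfold HausdorffConvergesTo
  refine squeeze_zero (fun n => hausdorffDist_nonneg) (fun n => ?_)
    (tendsto_one_div_add_atTop_nhds_zero_nat (𝕜 := ℝ))
  refine hausdorffDist_le_of_mem_dist (by positivity) (fun x hx => ?_) (hUX n)
  exact ⟨x, frontier_domain_subset hX.1.isClosed (hU n) hx, by rw [dist_self]; positivity⟩
end
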